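/- arXiv:math/0303359 — 4 statements merged into one kernel-verified Lean document; each statement's English description precedes it below -/
import Mathlib

section
/- Let p < q be odd primes and let H be a non-semisimple Hopf algebra over ℂ of dimension p·q with antipode S. Then S⁴ (the four-fold composite of S, viewed as an element of the monoid of ℂ-linear endomorphisms of H under composition) has order exactly p: (S⁴)^p = id_H and S⁴ ≠ id_H. -/
namespace HopfTools

section LinearAlgebra

open Polynomial Module

variable {V : Type*} [AddCommGroup V] [Module ℂ V] [FiniteDimensional ℂ V]

lemma pow_eq_one_of_mem_roots_charpoly {f : End ℂ V} {N : ℕ} (hf : f ^ N = 1) {z : ℂ}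
    (hz : z ∈ f.charpoly.roots) : z ^ N = 1 := by
  have h1 : f.HasEigenvalue z :=
    (End.hasEigenvalue_iff_isRoot_charpoly f z).2 (isRoot_of_mem_roots hz)
  obtain ⟨v, hv⟩ := h1.exists_hasEigenvector
  have h2 := hv.pow_apply N
  rw [hf] at h2
  have h3 : (z ^ N - 1) • v = 0 := by
    rw [sub_smul, one_smul, ← h2, End.one_apply, sub_self]
  exact sub_eq_zero.1 ((smul_eq_zero.1 h3).resolve_right hv.2)

lemma card_roots_charpoly (f : End ℂ V) : f.charpoly.roots.card = finrank ℂ V := by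
  rw [splits_iff_card_roots.1 (IsAlgClosed.splits f.charpoly), LinearMap.charpoly_natDegree]

lemma trace_eq_sum_roots (f : End ℂ V) : LinearMap.trace ℂ V f = f.charpoly.roots.sum :=
  End.trace_eq_sum_roots_charpoly_of_splits (IsAlgClosed.splits _)

lemma re_eq_one_of_sum_eq_card (s : Multiset ℂ) (hs : ∀ z ∈ s, ‖z‖ = 1) :
    s.sum.re ≤ s.card ∧ (s.sum.re = s.card → ∀ z ∈ s, z.re = 1) := by
  induction s using Multiset.induction with
  | empty => simp
  | cons a s ih =>
    obtain ⟨h1, h2⟩ := ih fun z hz => hs z (Multiset.mem_cons_of_mem hz)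
    have ha : a.re ≤ 1 := hs a (Multiset.mem_cons_self a s) ▸ Complex.re_le_norm a
    simp only [Multiset.sum_cons, Complex.add_re, Multiset.card_cons, Nat.cast_add, Nat.cast_one,
      Multiset.mem_cons, forall_eq_or_imp]
    exact ⟨by linarith, fun h => ⟨by linarith, h2 (by linarith)⟩⟩

lemma eq_one_of_trace_eq_finrank {f : End ℂ V} {N : ℕ} (hN : N ≠ 0) (hf : f ^ N = 1)
    (ht : LinearMap.trace ℂ V f = finrank ℂ V) : f = 1 := by
  have hnorm (z) (hz : z ∈ f.charpoly.roots) : ‖z‖ = 1 :=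
    Complex.norm_eq_one_of_pow_eq_one (pow_eq_one_of_mem_roots_charpoly hf hz) hN
  have h1 (z) (hz : z ∈ f.charpoly.roots) : z = 1 := by
    have hre : z.re = 1 := (re_eq_one_of_sum_eq_card _ hnorm).2
      (by rw [← trace_eq_sum_roots, ht, card_roots_charpoly]; simp) z hz
    have h2 := Complex.sq_norm z
    rw [hnorm z hz, Complex.normSq_apply, hre] at h2
    exact Complex.ext hre (by simp; nlinarith)
  have hint : IsIntegral ℂ f := Algebra.IsIntegral.isIntegral f
  have hsep : (minpoly ℂ f).Separable := by
    refine Separable.of_dvd (X_pow_sub_one_separable_iff.2 (Nat.cast_ne_zero.2 hN))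
      (minpoly.dvd ℂ f (?_ : aeval f (X ^ N - 1 : ℂ[X]) = 0))
    simp [hf]
  have hle : (minpoly ℂ f).roots ≤ {1} := by
    refine (Multiset.le_iff_subset (nodup_roots hsep)).2 fun z hz => ?_
    rw [Multiset.mem_singleton]
    refine h1 z ((mem_roots (LinearMap.charpoly_monic f).ne_zero).2 ?_)
    rw [← End.hasEigenvalue_iff_isRoot_charpoly]
    exact End.hasEigenvalue_of_isRoot (isRoot_of_mem_roots hz)
  have hdvd : minpoly ℂ f ∣ X - C 1 := by
    rw [(IsAlgClosed.splits (minpoly ℂ f)).eq_prod_roots_of_monic (minpoly.monic hint)]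
    refine (Multiset.prod_dvd_prod_of_le (Multiset.map_le_map hle)).trans ?_
    simp
  have h3 := aeval_eq_zero_of_dvd_aeval_eq_zero hdvd (minpoly.aeval ℂ f)
  simpa [sub_eq_zero] using h3

lemma sum_trace_pow_mul {f s : End ℂ V} {N : ℕ} (hf : f ^ N = 1)
    (hs : ∀ x ∈ End.eigenspace f 1, s x ∈ End.eigenspace f 1) :
    ∑ i ∈ Finset.range N, LinearMap.trace ℂ V (f ^ i * s) =
      N * LinearMap.trace ℂ (End.eigenspace f 1) (s.restrict hs) := by
  let P : End ℂ V := ∑ i ∈ Finset.range N, f ^ i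
  have hP : f * P = P := by
    have := mul_geom_sum f N
    rw [hf, sub_self, sub_mul, one_mul, sub_eq_zero] at this
    exact this
  have hPs (x : V) : (P * s) x ∈ End.eigenspace f 1 := by
    rw [End.mem_eigenspace_iff, one_smul, ← End.mul_apply, ← mul_assoc, hP]
  have hres : (P * s).restrict (fun x (_ : x ∈ End.eigenspace f 1) => hPs x) =
      (N : ℂ) • s.restrict hs := by
    ext ⟨x, hx⟩
    have hpow (i : ℕ) : (f ^ i) (s x) = s x := by
      induction i with
      | zero => simp
      | succ i ih =>
        rw [pow_succ', End.mul_apply, ih]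
        simpa using End.mem_eigenspace_iff.1 (hs x hx)
    simp [P, hpow, Nat.cast_smul_eq_nsmul]
  rw [← map_sum, ← Finset.sum_mul, ← smul_eq_mul (N : ℂ), ← map_smul, ← hres,
    LinearMap.trace_restrict_eq_of_forall_mem _ _ hPs]

lemma natCast_mul_finrank_eigenspace {f : End ℂ V} {N : ℕ} (hN : N ≠ 0) (hf : f ^ N = 1)
    (ht : ∀ i, 0 < i → i < N → LinearMap.trace ℂ V (f ^ i) = 0) :
    N * finrank ℂ (End.eigenspace f 1) = finrank ℂ V := by
  have h1 := sum_trace_pow_mul (s := 1) hf fun x hx => hx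
  have h2 : (1 : End ℂ V).restrict (fun x (hx : x ∈ End.eigenspace f 1) => hx) = 1 := rfl
  rw [h2, LinearMap.trace_one, Finset.sum_eq_single_of_mem 0 (by simp; lia)] at h1
  · rw [pow_zero, one_mul, LinearMap.trace_one] at h1
    exact_mod_cast h1.symm
  · intro i hi h0
    rw [mul_one, ht i (by lia) (by simpa using hi)]

lemma trace_pow_eq_zero {f : End ℂ V} (hf : IsOfFinOrder f)
    (ht : ∀ i, LinearMap.trace ℂ V (f ^ i) ^ 2 = finrank ℂ V * LinearMap.trace ℂ V (f ^ i))
    (i : ℕ) (hi0 : 0 < i) (hi : i < orderOf f) : LinearMap.trace ℂ V (f ^ i) = 0 := by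
  by_contra hne
  refine pow_ne_one_of_lt_orderOf hi0.ne' hi
    (eq_one_of_trace_eq_finrank hf.orderOf_pos.ne' ?_ (mul_right_cancel₀ hne ?_))
  · rw [← pow_mul, mul_comm, pow_mul, pow_orderOf_eq_one, one_pow]
  · rw [← sq, ht]

lemma exists_polynomial_of_pow_eq_one {r : ℕ} (hr : Odd r) {ω : ℂ} (hω : IsPrimitiveRoot ω r)
    (s : Multiset ℂ) (hs : ∀ z ∈ s, z ^ (2 * r) = 1) : ∃ P : ℤ[X], aeval ω P = s.sum ∧
      |P.eval 1| ≤ s.card ∧ P.eval 1 % 2 = (s.card : ℤ) % 2 := by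
  have : NeZero r := ⟨by rintro rfl; simp at hr⟩
  induction s using Multiset.induction with
  | empty => exact ⟨0, by simp⟩
  | cons a s ih =>
    obtain ⟨P, h1, h2, h3⟩ := ih fun z hz => hs z (Multiset.mem_cons_of_mem hz)
    have ha := hs a (Multiset.mem_cons_self a s)
    rw [mul_comm, pow_mul, sq_eq_one_iff] at ha
    rcases ha with ha | ha
    · obtain ⟨i, -, rfl⟩ := hω.eq_pow_of_pow_eq_one ha
      refine ⟨X ^ i + P, by simp [h1], ?_, by simp; lia⟩
      simp only [eval_add, eval_pow, eval_X, one_pow, Multiset.card_cons]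
      rw [abs_le] at *
      push_cast
      constructor <;> lia
    · have hb : (-a) ^ r = 1 := by rw [hr.neg_pow, ha, neg_neg]
      obtain ⟨i, -, hi⟩ := hω.eq_pow_of_pow_eq_one hb
      refine ⟨-X ^ i + P, by simp [h1, hi], ?_, ?_⟩
      · simp only [eval_add, eval_neg, eval_pow, eval_X, one_pow, Multiset.card_cons]
        rw [abs_le] at *
        push_cast
        constructor <;> lia
      · simp; lia

lemma trace_ne_zero_of_pow_eq_one {T : End ℂ V} {r : ℕ} (hr : r.Prime) (hr2 : Odd r)
    (hT : T ^ (2 * r) = 1) (hodd : Odd (finrank ℂ V)) (hlt : finrank ℂ V < r) :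
    LinearMap.trace ℂ V T ≠ 0 := by
  intro h0
  have : Fact r.Prime := ⟨hr⟩
  have hω := Complex.isPrimitiveRoot_exp r hr.ne_zero
  obtain ⟨P, h1, h2, h3⟩ := exists_polynomial_of_pow_eq_one hr2 hω T.charpoly.roots
    fun z hz => pow_eq_one_of_mem_roots_charpoly hT hz
  rw [← trace_eq_sum_roots, h0] at h1
  rw [card_roots_charpoly] at h2 h3
  have h4 : cyclotomic r ℤ ∣ P := by
    rw [cyclotomic_eq_minpoly hω hr.pos]
    exact minpoly.isIntegrallyClosed_dvd (hω.isIntegral hr.pos) h1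
  have h5 : (r : ℤ) ∣ P.eval 1 := by
    have := eval_dvd (x := 1) h4
    rwa [eval_one_cyclotomic_prime] at this
  have h6 : P.eval 1 = 0 := Int.eq_zero_of_abs_lt_dvd h5 (by lia)
  rw [h6] at h3
  obtain ⟨m, hm⟩ := hodd
  lia

end LinearAlgebra

open Coalgebra HopfAlgebra TensorProduct

section HopfAlgebra

variable {k H A : Type*} [Field k] [Ring H] [HopfAlgebra k H] [Ring A] [Algebra k A]

/-- The convolution product of two linear maps. -/
noncomputable def conv (f g : H →ₗ[k] A) : H →ₗ[k] A :=
  (WithConv.toConv f * WithConv.toConv g).ofConv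

local infixl:70 "⋆" => conv
local notation "𝑺" => antipode k (A := H)

/-- The convolution unit. -/
noncomputable def convUnit (k H A : Type*) [Field k] [Ring H] [HopfAlgebra k H] [Ring A]
    [Algebra k A] : H →ₗ[k] A := Algebra.linearMap k A ∘ₗ counit

/-- A linear functional, regarded as a map into the scalars of `A`. -/
noncomputable def scal (A : Type*) [Ring A] [Algebra k A] (q : H →ₗ[k] k) : H →ₗ[k] A :=
  Algebra.linearMap k A ∘ₗ q

@[simp] lemma scal_apply (q : H →ₗ[k] k) (h : H) : scal A q h = algebraMap k A (q h) := rfl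

@[simp] lemma convUnit_apply (h : H) : convUnit k H A h = algebraMap k A (counit h) := rfl

lemma scal_counit : scal A (counit : H →ₗ[k] k) = convUnit k H A := rfl

lemma conv_apply_repr (f g : H →ₗ[k] A) {ι : Type*} {h : H} (r : Repr k h ι) :
    (f ⋆ g) h = ∑ i ∈ r.index, f (r.left i) * g (r.right i) :=
  r.convMul_apply (WithConv.toConv f) (WithConv.toConv g)

lemma conv_assoc (f g l : H →ₗ[k] A) : f ⋆ g ⋆ l = f ⋆ (g ⋆ l) :=
  congrArg WithConv.ofConv
    (mul_assoc (WithConv.toConv f) (WithConv.toConv g) (WithConv.toConv l))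

@[simp] lemma conv_convUnit (f : H →ₗ[k] A) : f ⋆ convUnit k H A = f :=
  congrArg WithConv.ofConv (mul_one (WithConv.toConv f))

@[simp] lemma convUnit_conv (f : H →ₗ[k] A) : convUnit k H A ⋆ f = f :=
  congrArg WithConv.ofConv (one_mul (WithConv.toConv f))

lemma algHom_comp_conv {B : Type*} [Ring B] [Algebra k B] (ρ : A →ₐ[k] B) (f g : H →ₗ[k] A) :
    ρ.toLinearMap ∘ₗ (f ⋆ g) = (ρ.toLinearMap ∘ₗ f) ⋆ (ρ.toLinearMap ∘ₗ g) := by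
  ext h
  simp [conv_apply_repr _ _ (ℛ k h)]

lemma scal_conv (p q : H →ₗ[k] k) : scal A (p ⋆ q) = scal A p ⋆ scal A q :=
  algHom_comp_conv (Algebra.ofId k A) p q

lemma mulLeft_comp_conv (c : A) (f g : H →ₗ[k] A) :
    LinearMap.mulLeft k c ∘ₗ (f ⋆ g) = (LinearMap.mulLeft k c ∘ₗ f) ⋆ g := by
  ext h
  simp [conv_apply_repr _ _ (ℛ k h), mul_assoc]

lemma mulRight_comp_conv (c : A) (f g : H →ₗ[k] A) :
    LinearMap.mulRight k c ∘ₗ (f ⋆ g) = f ⋆ (LinearMap.mulRight k c ∘ₗ g) := by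
  ext h
  simp [conv_apply_repr _ _ (ℛ k h), mul_assoc]

lemma scal_conv_comm (q : H →ₗ[k] k) (h : H) (f : H →ₗ[k] A) {ι : Type*} (r : Repr k h ι) :
    (scal A q ⋆ f) h = ∑ i ∈ r.index, q (r.left i) • f (r.right i) := by
  simp [conv_apply_repr _ _ r, Algebra.smul_def]

lemma conv_scal_comm (q : H →ₗ[k] k) (h : H) (f : H →ₗ[k] A) {ι : Type*} (r : Repr k h ι) :
    (f ⋆ scal A q) h = ∑ i ∈ r.index, q (r.right i) • f (r.left i) := by
  simp [conv_apply_repr _ _ r, Algebra.smul_def, Algebra.commutes]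


lemma antipode_conv : 𝑺 ⋆ LinearMap.id = convUnit k H H :=
  congrArg WithConv.ofConv LinearMap.antipode_mul_id

lemma conv_antipode : LinearMap.id ⋆ 𝑺 = convUnit k H H :=
  congrArg WithConv.ofConv LinearMap.id_mul_antipode

lemma algHom_antipode_conv (ρ : H →ₐ[k] A) :
    (ρ.toLinearMap ∘ₗ 𝑺) ⋆ ρ.toLinearMap = convUnit k H A := by
  have := algHom_comp_conv ρ 𝑺 LinearMap.id
  rw [antipode_conv, LinearMap.comp_id] at this
  rw [← this]; ext h; simp

lemma algHom_conv_antipode (ρ : H →ₐ[k] A) :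
    ρ.toLinearMap ⋆ (ρ.toLinearMap ∘ₗ 𝑺) = convUnit k H A := by
  have := algHom_comp_conv ρ LinearMap.id 𝑺
  rw [conv_antipode, LinearMap.comp_id] at this
  rw [← this]; ext h; simp

/-- The operator `h ↦ ∑ q(h₂) h₁`. -/
noncomputable def hitL (q : H →ₗ[k] k) : Module.End k H := LinearMap.id ⋆ scal H q

/-- The operator `h ↦ ∑ q(h₁) h₂`. -/
noncomputable def hitR (q : H →ₗ[k] k) : Module.End k H := scal H q ⋆ LinearMap.id

lemma hitL_apply_repr (q : H →ₗ[k] k) {ι : Type*} {h : H} (r : Repr k h ι) :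
    hitL q h = ∑ i ∈ r.index, q (r.right i) • r.left i := by
  simp [hitL, conv_scal_comm _ _ _ r]

lemma hitR_apply_repr (q : H →ₗ[k] k) {ι : Type*} {h : H} (r : Repr k h ι) :
    hitR q h = ∑ i ∈ r.index, q (r.left i) • r.right i := by
  simp [hitR, scal_conv_comm _ _ _ r]

lemma comp_hitL (f : H →ₗ[k] A) (q : H →ₗ[k] k) : f ∘ₗ hitL q = f ⋆ scal A q := by
  ext h
  simp [hitL_apply_repr _ (ℛ k h), conv_scal_comm _ _ _ (ℛ k h)]

lemma comp_hitR (f : H →ₗ[k] A) (q : H →ₗ[k] k) : f ∘ₗ hitR q = scal A q ⋆ f := by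
  ext h
  simp [hitR_apply_repr _ (ℛ k h), scal_conv_comm _ _ _ (ℛ k h)]

lemma functional_hitL (p q : H →ₗ[k] k) (h : H) : p (hitL q h) = (p ⋆ q) h :=
  LinearMap.congr_fun (comp_hitL p q) h

lemma functional_hitR (p q : H →ₗ[k] k) (h : H) : p (hitR q h) = (q ⋆ p) h :=
  LinearMap.congr_fun (comp_hitR p q) h

lemma hitL_comp_hitL (p q : H →ₗ[k] k) : hitL p ∘ₗ hitL q = hitL (p ⋆ q) := by
  rw [comp_hitL, hitL, hitL, conv_assoc, scal_conv]

lemma hitR_comp_hitR (p q : H →ₗ[k] k) : hitR p ∘ₗ hitR q = hitR (q ⋆ p) := by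
  rw [comp_hitR, hitR, hitR, ← conv_assoc, scal_conv]

lemma hitL_comp_hitR (p q : H →ₗ[k] k) : hitL p ∘ₗ hitR q = hitR q ∘ₗ hitL p := by
  rw [comp_hitR, comp_hitL, hitR, hitL, conv_assoc]

@[simp] lemma hitL_counit : hitL (counit : H →ₗ[k] k) = LinearMap.id := by
  rw [hitL, scal_counit, conv_convUnit]

@[simp] lemma hitR_counit : hitR (counit : H →ₗ[k] k) = LinearMap.id := by
  rw [hitR, scal_counit, convUnit_conv]

section Basis

variable {ι : Type*} [Fintype ι] (b : Module.Basis ι k H)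

lemma conv_apply_basis (f g : H →ₗ[k] A) (h : H) :
    (f ⋆ g) h = ∑ j, f (hitL (b.coord j) h) * g (b j) := by
  have key (x : H) : g x = ∑ j, b.coord j x • g (b j) := by
    conv_lhs => rw [← b.sum_repr x]
    simp only [map_sum, map_smul, Module.Basis.coord_apply]
  simp only [hitL_apply_repr _ (ℛ k h), conv_apply_repr _ _ (ℛ k h), map_sum, map_smul,
    Finset.sum_mul]
  rw [Finset.sum_comm]
  refine Finset.sum_congr rfl fun i _ => ?_
  rw [key, Finset.mul_sum]
  simp

lemma conv_apply_basis' (f g : H →ₗ[k] A) (h : H) :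
    (f ⋆ g) h = ∑ j, f (b j) * g (hitR (b.coord j) h) := by
  have key (x : H) : f x = ∑ j, b.coord j x • f (b j) := by
    conv_lhs => rw [← b.sum_repr x]
    simp only [map_sum, map_smul, Module.Basis.coord_apply]
  simp only [hitR_apply_repr _ (ℛ k h), conv_apply_repr _ _ (ℛ k h), map_sum, map_smul,
    Finset.mul_sum]
  rw [Finset.sum_comm]
  refine Finset.sum_congr rfl fun i _ => ?_
  rw [key, Finset.sum_mul]
  simp

end Basis

/-- `h ↦ h ⊗ 1`. -/
noncomputable abbrev inl : H →ₐ[k] H ⊗[k] H := Algebra.TensorProduct.includeLeft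

/-- `h ↦ 1 ⊗ h`. -/
noncomputable abbrev inr : H →ₐ[k] H ⊗[k] H := Algebra.TensorProduct.includeRight

lemma comul_eq_conv :
    (comul : H →ₗ[k] H ⊗[k] H) = inl.toLinearMap ⋆ inr.toLinearMap := by
  ext h
  rw [conv_apply_repr _ _ (ℛ k h)]
  simp [(ℛ k h).eq]

lemma comul_comp_antipode : (comul : H →ₗ[k] H ⊗[k] H) ∘ₗ 𝑺 =
    (inr.toLinearMap ∘ₗ 𝑺) ⋆ (inl.toLinearMap ∘ₗ 𝑺) := by
  have h1 := algHom_antipode_conv (Bialgebra.comulAlgHom k H)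
  have e : (Bialgebra.comulAlgHom k H).toLinearMap = (comul : H →ₗ[k] H ⊗[k] H) := rfl
  have h2 : (comul : H →ₗ[k] H ⊗[k] H) ⋆
      ((inr.toLinearMap ∘ₗ 𝑺) ⋆ (inl.toLinearMap ∘ₗ 𝑺)) = convUnit k H _ := by
    rw [comul_eq_conv, conv_assoc, ← conv_assoc inr.toLinearMap, algHom_conv_antipode,
      convUnit_conv, algHom_conv_antipode]
  rw [e] at h1
  rw [← convUnit_conv (_ ⋆ _), ← h1, conv_assoc, h2, conv_convUnit]

lemma comul_antipode_repr {ι : Type*} {h : H} (r : Repr k h ι) :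
    comul (R := k) (antipode k h) =
      ∑ i ∈ r.index, antipode k (r.right i) ⊗ₜ[k] antipode k (r.left i) := by
  have := LinearMap.congr_fun (comul_comp_antipode (k := k) (H := H)) h
  rw [conv_apply_repr _ _ r] at this
  simpa using this

/-- The representation of `Δ(S(h))` induced by one of `Δ(h)`. -/
noncomputable def reprAntipode {ι : Type*} {h : H} (r : Repr k h ι) :
    Repr k (antipode k h) ι where
  index := r.index
  left i := antipode k (r.right i)
  right i := antipode k (r.left i)
  eq := (comul_antipode_repr r).symm

lemma hitL_antipode (q : H →ₗ[k] k) (h : H) :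
    hitL q (antipode k h) = antipode k (hitR (q ∘ₗ 𝑺) h) := by
  rw [hitL_apply_repr _ (reprAntipode (ℛ k h)), hitR_apply_repr _ (ℛ k h)]
  simp [reprAntipode]

lemma hitR_antipode (q : H →ₗ[k] k) (h : H) :
    hitR q (antipode k h) = antipode k (hitL (q ∘ₗ 𝑺) h) := by
  rw [hitR_apply_repr _ (reprAntipode (ℛ k h)), hitL_apply_repr _ (ℛ k h)]
  simp [reprAntipode]

/-- Contraction of the second tensor factor with a functional. -/
noncomputable def contractRight (q : H →ₗ[k] k) : H ⊗[k] H →ₗ[k] H :=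
  (TensorProduct.rid k H).toLinearMap ∘ₗ LinearMap.lTensor H q

@[simp] lemma contractRight_tmul (q : H →ₗ[k] k) (x y : H) :
    contractRight q (x ⊗ₜ[k] y) = q y • x := by
  simp [contractRight]

lemma contractRight_comul (q : H →ₗ[k] k) (a : H) : contractRight q (comul a) = hitL q a := by
  rw [hitL_apply_repr q (ℛ k a), ← (ℛ k a).eq]
  simp

lemma contractRight_inl_mul (q : H →ₗ[k] k) (x : H) (t : H ⊗[k] H) :
    contractRight q (inl (k := k) x * t) = x * contractRight q t := by
  induction t with
  | zero => simp
  | tmul y z => simp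
  | add s t hs ht => rw [mul_add, map_add, map_add, hs, ht, mul_add]

lemma contractRight_inr_mul (q : H →ₗ[k] k) (x : H) (t : H ⊗[k] H) :
    contractRight q (inr (k := k) x * t) = contractRight (q ∘ₗ LinearMap.mulLeft k x) t := by
  induction t with
  | zero => simp
  | tmul y z => simp
  | add s t hs ht => rw [mul_add, map_add, map_add, hs, ht]

section Basis

variable {ι : Type*} [Fintype ι] (b : Module.Basis ι k H)

lemma inl_antipode_antipode (h : H) : inl (k := k) (antipode k (antipode k h)) =
    ∑ j, inr (k := k) (antipode k (b j)) *
      comul (R := k) (antipode k (antipode k (hitL (b.coord j) h))) := by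
  let o : H ⊗[k] H →ₗ[k] (H ⊗[k] H)ᵐᵒᵖ := (MulOpposite.opLinearEquiv k).toLinearMap
  have e1 : (o ∘ₗ inl.toLinearMap ∘ₗ 𝑺 ∘ₗ 𝑺) ⋆ (o ∘ₗ inr.toLinearMap ∘ₗ 𝑺 ∘ₗ 𝑺) =
      o ∘ₗ comul ∘ₗ 𝑺 ∘ₗ 𝑺 := by
    ext x
    rw [conv_apply_repr _ _ (ℛ k x)]
    simp [← (reprAntipode (reprAntipode (ℛ k x))).eq, o, reprAntipode, ← MulOpposite.op_mul]
  have e2 : (o ∘ₗ inr.toLinearMap ∘ₗ 𝑺 ∘ₗ 𝑺) ⋆ (o ∘ₗ inr.toLinearMap ∘ₗ 𝑺) =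
      convUnit k H _ := by
    ext x
    rw [conv_apply_repr _ _ (ℛ k x)]
    have := congrArg (fun y => MulOpposite.op (inr (k := k) (antipode k y)))
      (sum_antipode_mul_eq_smul (ℛ k x))
    simp only [map_sum, antipode_mul_antidistrib] at this
    have h1 : (MulOpposite.op ((1 : H) ⊗ₜ[k] (1 : H))) = 1 := rfl
    simpa [o, ← MulOpposite.op_mul, Algebra.algebraMap_eq_smul_one, ← map_mul, h1] using this
  have e3 := LinearMap.congr_fun (congrArg (· ⋆ (o ∘ₗ inr.toLinearMap ∘ₗ 𝑺)) e1) h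
  simp only [conv_assoc, e2, conv_convUnit] at e3
  rw [conv_apply_basis b] at e3
  apply MulOpposite.op_injective
  simpa [o] using e3

lemma antipode_antipode_mul_hitL (q : H →ₗ[k] k) (a h : H) :
    antipode k (antipode k h) * hitL q a =
      ∑ j, hitL (q ∘ₗ LinearMap.mulLeft k (antipode k (b j)))
        (antipode k (antipode k (hitL (b.coord j) h)) * a) := by
  rw [← contractRight_comul, ← contractRight_inl_mul, inl_antipode_antipode b, Finset.sum_mul,
    map_sum]
  refine Finset.sum_congr rfl fun j _ => ?_
  rw [mul_assoc, contractRight_inr_mul, ← Bialgebra.comul_mul, contractRight_comul]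

lemma sum_hitL_comp_hitL (q : H →ₗ[k] k) :
    ∑ j, hitL (b.coord j) ∘ₗ hitL (q ∘ₗ LinearMap.mulLeft k (antipode k (b j))) =
      q 1 • LinearMap.id := by
  have key (y : H) :
      ∑ j, (b.coord j ⋆ (q ∘ₗ LinearMap.mulLeft k (antipode k (b j)))) y = q 1 * counit y := by
    have h1 := congrArg q (sum_antipode_mul_eq_smul (ℛ k y))
    simp only [conv_apply_repr _ _ (ℛ k y)]
    rw [Finset.sum_comm]
    rw [map_smul, map_sum, smul_eq_mul, mul_comm] at h1
    rw [← h1]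
    refine Finset.sum_congr rfl fun i _ => ?_
    conv_rhs => rw [← b.sum_repr ((ℛ k y).left i)]
    simp only [map_sum, map_smul, Finset.sum_mul, smul_mul_assoc, Module.Basis.coord_apply]
    rfl
  ext h
  simp only [hitL_comp_hitL, LinearMap.sum_apply, hitL_apply_repr _ (ℛ k h)]
  rw [Finset.sum_comm]
  simp only [← Finset.sum_smul, key, mul_smul, ← Finset.smul_sum, LinearMap.smul_apply,
    LinearMap.id_apply]
  rw [← hitL_apply_repr counit (ℛ k h), hitL_counit, LinearMap.id_apply]

end Basis

/-- Right integrals in the dual of `H`. -/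
def IsRightIntegral (l : H →ₗ[k] k) : Prop := ∀ q : H →ₗ[k] k, l ⋆ q = q 1 • l

/-- The functional `a ↦ Tr(h ↦ ∑ p(h₁) S²(h₂) a)`. -/
noncomputable def traceForm (p : H →ₗ[k] k) : H →ₗ[k] k where
  toFun a := LinearMap.trace k H (LinearMap.mulRight k a ∘ₗ 𝑺 ∘ₗ 𝑺 ∘ₗ hitR p)
  map_add' a b := by
    rw [← map_add]
    congr 1; ext h; simp [mul_add]
  map_smul' c a := by
    rw [RingHom.id_apply, ← map_smul]
    congr 1; ext h; simp

lemma traceForm_apply (p : H →ₗ[k] k) (a : H) : traceForm p a =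
    LinearMap.trace k H (LinearMap.mulRight k a ∘ₗ 𝑺 ∘ₗ 𝑺 ∘ₗ hitR p) := rfl

lemma isRightIntegral_traceForm [FiniteDimensional k H] (p : H →ₗ[k] k) :
    IsRightIntegral (traceForm p) := by
  intro q
  ext a
  let b := Module.finBasis k H
  rw [← functional_hitL, traceForm_apply]
  have h1 : LinearMap.mulRight k (hitL q a) ∘ₗ 𝑺 ∘ₗ 𝑺 ∘ₗ hitR p =
      ∑ j, hitL (q ∘ₗ LinearMap.mulLeft k (antipode k (b j))) *
        ((LinearMap.mulRight k a ∘ₗ 𝑺 ∘ₗ 𝑺 ∘ₗ hitR p) * hitL (b.coord j)) := by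
    ext h
    simp only [LinearMap.comp_apply, LinearMap.mulRight_apply, antipode_antipode_mul_hitL b,
      LinearMap.sum_apply, Module.End.mul_apply]
    refine Finset.sum_congr rfl fun j _ => ?_
    rw [← LinearMap.comp_apply (hitL (b.coord j)), hitL_comp_hitR, LinearMap.comp_apply]
  have h2 : ∑ j, ((LinearMap.mulRight k a ∘ₗ 𝑺 ∘ₗ 𝑺 ∘ₗ hitR p) * hitL (b.coord j)) *
      hitL (q ∘ₗ LinearMap.mulLeft k (antipode k (b j))) =
      q 1 • (LinearMap.mulRight k a ∘ₗ 𝑺 ∘ₗ 𝑺 ∘ₗ hitR p) := by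
    simp only [mul_assoc]
    rw [← Finset.mul_sum]
    have := sum_hitL_comp_hitL b q
    simp only [← Module.End.mul_eq_comp] at this
    rw [this]
    ext x
    simp
  rw [h1, map_sum]
  simp only [LinearMap.trace_mul_comm k (hitL (q ∘ₗ _))]
  rw [← map_sum, h2, map_smul]
  rfl

lemma exists_isRightIntegral [FiniteDimensional k H] :
    ∃ l : H →ₗ[k] k, IsRightIntegral l ∧ l ≠ 0 := by
  by_contra! hcon
  let b := Module.finBasis k H
  have h0 : ∑ j, traceForm (b.coord j) (antipode k (b j)) = 0 :=
    Finset.sum_eq_zero fun j _ => by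
      rw [hcon _ (isRightIntegral_traceForm (b.coord j)), LinearMap.zero_apply]
  simp only [traceForm_apply] at h0
  rw [← map_sum] at h0
  have h1 : ∑ j, LinearMap.mulRight k (antipode k (b j)) ∘ₗ 𝑺 ∘ₗ 𝑺 ∘ₗ hitR (b.coord j) =
      (counit : H →ₗ[k] k).smulRight (1 : H) := by
    ext y
    have h2 := congrArg 𝑺 (LinearMap.congr_fun (conv_antipode (k := k) (H := H)) y)
    rw [conv_apply_basis' b, map_sum] at h2
    simp only [antipode_mul_antidistrib] at h2
    simpa [Algebra.algebraMap_eq_smul_one] using h2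
  rw [h1, LinearMap.trace_smulRight] at h0
  simp at h0

section Pairing

variable {l : H →ₗ[k] k}

lemma eq_of_forall_functional {x y : H} (h : ∀ q : H →ₗ[k] k, q x = q y) : x = y := by
  rw [← sub_eq_zero, ← Module.forall_dual_apply_eq_zero_iff k]
  intro q
  rw [map_sub, h q, sub_self]

lemma IsRightIntegral.apply_hitL (hl : IsRightIntegral l) (q : H →ₗ[k] k) (a : H) :
    l (hitL q a) = q 1 * l a := by
  rw [functional_hitL, hl q]; rfl

lemma IsRightIntegral.hitR_eq (hl : IsRightIntegral l) (a : H) :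
    hitR l a = algebraMap k H (l a) := by
  refine eq_of_forall_functional (k := k) fun q => ?_
  rw [functional_hitR, hl q, Algebra.algebraMap_eq_smul_one]
  simp [mul_comm]

/-- The representation of `Δ(S(b)a)` induced by those of `Δ(b)` and `Δ(a)`. -/
noncomputable def reprAntipodeMul {ι κ : Type*} {b a : H} (r : Repr k b ι) (s : Repr k a κ) :
    Repr k (antipode k b * a) (ι × κ) where
  index := r.index ×ˢ s.index
  left i := antipode k (r.right i.1) * s.left i.2
  right i := antipode k (r.left i.1) * s.right i.2
  eq := by
    rw [Bialgebra.comul_mul, comul_antipode_repr r, ← s.eq, Finset.sum_mul_sum,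
      Finset.sum_product]
    simp

lemma antipode_conv_eq (q : H →ₗ[k] k) (a : H) (v : H →ₗ[k] H)
    (hv : ∀ b, v b = hitR (q ∘ₗ LinearMap.mulLeft k (antipode k b)) a) (b : H) :
    (𝑺 ⋆ v) b = hitR q (antipode k b * a) := by
  rw [conv_apply_repr _ _ (ℛ k b), hitR_apply_repr _ (reprAntipodeMul (ℛ k b) (ℛ k a))]
  simp only [reprAntipodeMul]
  rw [Finset.sum_product]
  refine Finset.sum_congr rfl fun i _ => ?_
  rw [hv, hitR_apply_repr _ (ℛ k a), Finset.mul_sum]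
  refine Finset.sum_congr rfl fun j _ => ?_
  simp

lemma IsRightIntegral.antipode_mul_hitL (hl : IsRightIntegral l) (q : H →ₗ[k] k) (a b : H) :
    l (antipode k b * hitL q a) = l (antipode k (hitR q b) * a) := by
  let v : H →ₗ[k] H :=
    { toFun b := hitR (l ∘ₗ LinearMap.mulLeft k (antipode k b)) a
      map_add' x y := by
        simp [hitR_apply_repr _ (ℛ k a), add_mul, add_smul, Finset.sum_add_distrib]
      map_smul' c x := by
        simp [hitR_apply_repr _ (ℛ k a), Finset.smul_sum, smul_smul] }
  have h1 : 𝑺 ⋆ v = scal H (l ∘ₗ LinearMap.mulRight k a ∘ₗ 𝑺) := by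
    ext b
    rw [antipode_conv_eq l a v (fun _ => rfl), hl.hitR_eq]
    rfl
  have h2 : v = LinearMap.id ⋆ scal H (l ∘ₗ LinearMap.mulRight k a ∘ₗ 𝑺) := by
    rw [← h1, ← conv_assoc, conv_antipode, convUnit_conv]
  have h3 := congrArg q (LinearMap.congr_fun h2 b)
  have h4 : q (v b) = l (antipode k b * hitL q a) := by
    change q (hitR (l ∘ₗ LinearMap.mulLeft k (antipode k b)) a) = _
    rw [functional_hitR, ← functional_hitL]
    rfl
  rw [← h4, h3]
  change q (hitL _ b) = _
  rw [functional_hitL, ← functional_hitR]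
  rfl

variable [FiniteDimensional k H]

lemma IsRightIntegral.eq_zero_of_forall (hl : IsRightIntegral l) (hl0 : l ≠ 0) {b : H}
    (hb : ∀ a, l (antipode k b * a) = 0) : b = 0 := by
  have hε (b : H) (hb : ∀ a, l (antipode k b * a) = 0) : counit (R := k) b = 0 := by
    by_contra hne
    refine hl0 (LinearMap.ext fun c => ?_)
    let e := Module.finBasis k H
    have h2 := congrArg 𝑺 (LinearMap.congr_fun (antipode_conv (k := k) (H := H)) b)
    rw [conv_apply_basis' e, map_sum] at h2
    simp only [antipode_mul_antidistrib, LinearMap.id_apply] at h2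
    have h3 := congrArg (fun y => l (y * c)) h2
    simp only [Finset.sum_mul, map_sum, mul_assoc] at h3
    rw [Finset.sum_eq_zero fun j _ => by rw [← hl.antipode_mul_hitL, hb]] at h3
    simp only [convUnit_apply, Algebra.algebraMap_eq_smul_one, map_smul, antipode_one,
      smul_mul_assoc, one_mul, smul_eq_mul] at h3
    simpa [hne] using h3.symm
  refine eq_of_forall_functional (k := k) fun q => ?_
  have := hε (hitR q b) fun a => by rw [← hl.antipode_mul_hitL, hb]
  rw [functional_hitR, ← functional_hitL, hitL_counit] at this
  simpa using this

/-- The map `b ↦ l(S(b) ·)` from `H` to its dual. -/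
noncomputable def pairing (l : H →ₗ[k] k) : H →ₗ[k] Module.Dual k H :=
  LinearMap.llcomp k H H k l ∘ₗ LinearMap.mul k H ∘ₗ 𝑺

omit [FiniteDimensional k H] in
@[simp] lemma pairing_apply (l : H →ₗ[k] k) (b a : H) : pairing l b a = l (antipode k b * a) := rfl

lemma IsRightIntegral.pairing_injective (hl : IsRightIntegral l) (hl0 : l ≠ 0) :
    Function.Injective (pairing l) := by
  rw [injective_iff_map_eq_zero]
  exact fun b hb => hl.eq_zero_of_forall hl0 fun a => LinearMap.congr_fun hb a

lemma IsRightIntegral.pairing_surjective (hl : IsRightIntegral l) (hl0 : l ≠ 0) :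
    Function.Surjective (pairing l) :=
  (LinearMap.injective_iff_surjective_of_finrank_eq_finrank
    (Subspace.dual_finrank_eq).symm).1 (hl.pairing_injective hl0)

lemma antipode_injective : Function.Injective 𝑺 := by
  obtain ⟨l, hl, hl0⟩ := exists_isRightIntegral (k := k) (H := H)
  rw [injective_iff_map_eq_zero]
  exact fun b hb => hl.eq_zero_of_forall hl0 fun a => by rw [hb]; simp

lemma antipode_surjective : Function.Surjective 𝑺 :=
  LinearMap.injective_iff_surjective.1 antipode_injective

/-- A right integral `l` of the dual together with the element `t` with `l(S(t) ·) = ε`. -/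
structure IsIntegralPair (l : H →ₗ[k] k) (t : H) : Prop where
  right : IsRightIntegral l
  pairing_eq : ∀ a, l (antipode k t * a) = counit a

omit [FiniteDimensional k H] in
variable (k H) in
lemma exists_isIntegralPair [FiniteDimensional k H] :
    ∃ (l : H →ₗ[k] k) (t : H), IsIntegralPair l t := by
  obtain ⟨l, hl, hl0⟩ := exists_isRightIntegral (k := k) (H := H)
  obtain ⟨t, ht⟩ := hl.pairing_surjective hl0 counit
  exact ⟨l, t, hl, fun a => LinearMap.congr_fun ht a⟩

namespace IsIntegralPair

variable {t : H} (hlt : IsIntegralPair l t)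
include hlt

omit [FiniteDimensional k H] in
lemma apply_antipode : l (antipode k t) = 1 := by
  simpa using hlt.pairing_eq 1

omit [FiniteDimensional k H] in
lemma ne_zero : l ≠ 0 := by
  rintro rfl
  simpa using hlt.apply_antipode

lemma mul_eq (h : H) : h * t = counit (R := k) h • t := by
  refine hlt.right.pairing_injective hlt.ne_zero (LinearMap.ext fun a => ?_)
  simp [mul_assoc, antipode_mul_antidistrib, hlt.pairing_eq]

lemma eq_smul {t' : H} (ht' : ∀ h, h * t' = counit (R := k) h • t') :
    t' = l (antipode k t') • t := by
  refine hlt.right.pairing_injective hlt.ne_zero (LinearMap.ext fun a => ?_)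
  obtain ⟨h, rfl⟩ := antipode_surjective (k := k) a
  rw [pairing_apply, ← antipode_mul_antidistrib, ht']
  simp [hlt.pairing_eq, mul_comm]

lemma exists_eq_smul {m : H →ₗ[k] k} (hm : IsRightIntegral m) : ∃ c : k, m = c • l := by
  obtain ⟨b, rfl⟩ := hlt.right.pairing_surjective hlt.ne_zero m
  refine ⟨counit b, ?_⟩
  have h1 (q : H →ₗ[k] k) : hitR q b = q 1 • b := by
    refine hlt.right.pairing_injective hlt.ne_zero (LinearMap.ext fun a => ?_)
    rw [pairing_apply, ← hlt.right.antipode_mul_hitL, ← pairing_apply, hm.apply_hitL]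
    simp
  have h2 : b = counit (R := k) b • (1 : H) := by
    refine eq_of_forall_functional (k := k) fun q => ?_
    have := congrArg (counit (R := k)) (h1 q)
    rw [functional_hitR, ← functional_hitL, hitL_counit] at this
    simpa [mul_comm] using this
  ext a
  rw [pairing_apply, h2]
  simp

end IsIntegralPair

end Pairing

lemma casimir {t : H} (ht : ∀ h, h * t = counit (R := k) h • t) {ι : Type*} (r : Repr k t ι)
    (x : H) :
    ∑ i ∈ r.index, (x * r.left i) ⊗ₜ[k] antipode k (r.right i) =
      ∑ i ∈ r.index, r.left i ⊗ₜ[k] (antipode k (r.right i) * x) := by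
  let C : H ⊗[k] H := ∑ i ∈ r.index, r.left i ⊗ₜ[k] antipode k (r.right i)
  have h1 : (LinearMap.mulRight k C ∘ₗ inl.toLinearMap) ⋆ (inr.toLinearMap ∘ₗ 𝑺) =
      LinearMap.mulLeft k C ∘ₗ convUnit k H (H ⊗[k] H) := by
    ext h
    have h2 := congrArg (LinearMap.lTensor H 𝑺) (congrArg (comul (R := k)) (ht h))
    rw [Bialgebra.comul_mul, map_smul, ← r.eq, ← (ℛ k h).eq, Finset.sum_mul_sum] at h2
    simp only [map_sum, map_smul, Algebra.TensorProduct.tmul_mul_tmul, LinearMap.lTensor_tmul,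
      antipode_mul_antidistrib] at h2
    rw [conv_apply_repr _ _ (ℛ k h)]
    simp only [LinearMap.comp_apply, LinearMap.mulRight_apply, LinearMap.mulLeft_apply,
      AlgHom.toLinearMap_apply, convUnit_apply, C, Finset.mul_sum, Finset.sum_mul,
      Algebra.TensorProduct.includeLeft_apply, Algebra.TensorProduct.includeRight_apply,
      Algebra.TensorProduct.tmul_mul_tmul, one_mul, mul_one]
    rw [h2, ← Finset.sum_mul, Algebra.algebraMap_eq_smul_one, mul_smul_comm, mul_one]
  have h3 := congrArg (· ⋆ (inr (k := k) (H := H)).toLinearMap) h1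
  simp only [conv_assoc, algHom_antipode_conv, conv_convUnit] at h3
  rw [← mulLeft_comp_conv, convUnit_conv] at h3
  simpa [C, Finset.mul_sum, Finset.sum_mul] using LinearMap.congr_fun h3 x

/-- Maschke's theorem for Hopf algebras. -/
lemma isSemisimpleRing_of_counit_ne_zero {t : H} (ht : ∀ h, h * t = counit (R := k) h • t)
    (hne : counit (R := k) t ≠ 0) : IsSemisimpleRing H := by
  refine { exists_isCompl := fun p => ?_ }
  obtain ⟨π, hπp, hπ⟩ : ∃ π : H →ₗ[k] H, (∀ x, π x ∈ p) ∧ ∀ x ∈ p, π x = x := by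
    obtain ⟨π, hπ⟩ := LinearMap.exists_leftInverse_of_injective
      (p.restrictScalars k).subtype (Submodule.ker_subtype _)
    exact ⟨(p.restrictScalars k).subtype ∘ₗ π, fun x => (π x).2, fun x hx =>
      congrArg Subtype.val (LinearMap.congr_fun hπ ⟨x, hx⟩)⟩
  let r := ℛ k t
  let P : H →ₗ[H] H :=
    { toFun x := (counit (R := k) t)⁻¹ • ∑ i ∈ r.index, r.left i * π (antipode k (r.right i) * x)
      map_add' x y := by simp [mul_add, Finset.sum_add_distrib]
      map_smul' h x := by
        have h1 := congrArg
          (LinearMap.mul' k H ∘ₗ LinearMap.lTensor H (π ∘ₗ LinearMap.mulRight k x)) (casimir ht r h)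
        simp only [map_sum] at h1
        simpa [Finset.mul_sum, mul_assoc] using
          congrArg ((counit (R := k) t)⁻¹ • ·) h1.symm }
  have hP (x : H) : P x ∈ p :=
    (p.restrictScalars k).smul_mem _ (Submodule.sum_mem _ fun i _ => p.smul_mem _ (hπp _))
  refine ⟨_, LinearMap.isCompl_of_proj (f := P.codRestrict p hP) fun x => Subtype.ext ?_⟩
  have h3 := congrArg (· * (x : H)) (sum_mul_antipode_eq_smul (R := k) r)
  simp only [Finset.sum_mul, mul_assoc, smul_mul_assoc, one_mul] at h3
  change (counit (R := k) t)⁻¹ • ∑ i ∈ r.index, r.left i * π (antipode k (r.right i) * x) = x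
  have h2 (i) : π (antipode k (r.right i) * x) = antipode k (r.right i) * x :=
    hπ _ (p.smul_mem (antipode k (r.right i)) x.2)
  simp only [h2]
  rw [h3, smul_smul, inv_mul_cancel₀ hne, one_smul]

namespace IsIntegralPair

variable [FiniteDimensional k H] {l : H →ₗ[k] k} {t : H} (hlt : IsIntegralPair l t)
include hlt

lemma eq_sum {ι : Type*} (r : Repr k t ι) (x : H) :
    x = ∑ i ∈ r.index, l (antipode k (r.right i) * x) • r.left i := by
  have h1 : hitL (l ∘ₗ 𝑺) t = 1 := by
    apply antipode_injective (k := k)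
    rw [← hitR_antipode, hlt.right.hitR_eq, hlt.apply_antipode]
    simp
  have h2 := congrArg (contractRight l) (casimir hlt.mul_eq r x)
  rw [hitL_apply_repr _ r] at h1
  simp only [map_sum, contractRight_tmul] at h2
  rw [← h2]
  conv_lhs => rw [← mul_one x, ← h1, Finset.mul_sum]
  simp

lemma trace_eq_sum {ι : Type*} (r : Repr k t ι) (f : Module.End k H) :
    LinearMap.trace k H f = ∑ i ∈ r.index, l (antipode k (r.right i) * f (r.left i)) := by
  have : f = ∑ i ∈ r.index,
      (l ∘ₗ LinearMap.mulLeft k (antipode k (r.right i))).smulRight (f (r.left i)) := by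
    ext x
    conv_lhs => rw [hlt.eq_sum r x]
    simp
  conv_lhs => rw [this]
  simp [LinearMap.trace_smulRight]

lemma traceForm_eq (β : H →ₗ[k] k) (a : H) : traceForm β a = β t * l a := by
  rw [traceForm_apply, hlt.trace_eq_sum (ℛ k t)]
  have h1 : (𝑺 ∘ₗ hitR β) ⋆ LinearMap.id = scal H β := by
    rw [comp_hitR, conv_assoc, antipode_conv, conv_convUnit]
  have h2 := congrArg (fun x => l (antipode k x * a)) (LinearMap.congr_fun h1 t)
  rw [conv_apply_repr _ _ (ℛ k t)] at h2
  simp only [map_sum, antipode_mul_antidistrib, Finset.sum_mul, scal_apply,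
    Algebra.algebraMap_eq_smul_one, map_smul, antipode_one, smul_mul_assoc, one_mul,
    smul_eq_mul] at h2
  simpa [mul_assoc] using h2

lemma eq_of_forall_apply_mul {x y : H} (h : ∀ a, l (x * a) = l (y * a)) : x = y := by
  rw [← sub_eq_zero]
  obtain ⟨b, hb⟩ := antipode_surjective (k := k) (x - y)
  rw [← hb, hlt.right.eq_zero_of_forall hlt.ne_zero (b := b), map_zero]
  intro a
  rw [hb, sub_mul, map_sub, h, sub_self]

end IsIntegralPair

lemma algHom_antipode_antipode (α : H →ₐ[k] k) :
    α.toLinearMap ∘ₗ 𝑺 ∘ₗ 𝑺 = α.toLinearMap := by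
  have h1 : (α.toLinearMap ∘ₗ 𝑺) ⋆ (α.toLinearMap ∘ₗ 𝑺 ∘ₗ 𝑺) = convUnit k H k := by
    ext h
    have := congrArg (fun x => α (antipode k x)) (sum_mul_antipode_eq_smul (R := k) (ℛ k h))
    rw [conv_apply_repr _ _ (ℛ k h)]
    simp only [map_sum, antipode_mul_antidistrib, map_mul, map_smul, antipode_one, map_one] at this
    simpa [mul_comm] using this
  rw [← convUnit_conv (_ ∘ₗ 𝑺 ∘ₗ 𝑺), ← algHom_conv_antipode α, conv_assoc, h1, conv_convUnit]

lemma hitL_antipode_antipode (α : H →ₐ[k] k) (h : H) :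
    hitL α.toLinearMap (antipode k (antipode k h)) =
      antipode k (antipode k (hitL α.toLinearMap h)) := by
  rw [hitL_antipode, hitR_antipode, LinearMap.comp_assoc, algHom_antipode_antipode]

lemma hitR_antipode_antipode (α : H →ₐ[k] k) (h : H) :
    hitR α.toLinearMap (antipode k (antipode k h)) =
      antipode k (antipode k (hitR α.toLinearMap h)) := by
  rw [hitR_antipode, hitL_antipode, LinearMap.comp_assoc, algHom_antipode_antipode]

lemma hitL_mul (α : H →ₐ[k] k) (x y : H) :
    hitL α.toLinearMap (x * y) = hitL α.toLinearMap x * hitL α.toLinearMap y := by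
  rw [← contractRight_comul, Bialgebra.comul_mul, hitL_apply_repr _ (ℛ k x),
    hitL_apply_repr _ (ℛ k y), ← (ℛ k x).eq, ← (ℛ k y).eq, Finset.sum_mul_sum,
    Finset.sum_mul_sum]
  simp [smul_smul, mul_comm]

lemma hitL_groupLike (q : H →ₗ[k] k) {g : H} (hg : IsGroupLikeElem k g) :
    hitL q g = q g • g := by
  rw [← contractRight_comul, hg.comul_eq_tmul_self, contractRight_tmul]

namespace IsIntegralPair

variable [FiniteDimensional k H] {l : H →ₗ[k] k} {t : H} (hlt : IsIntegralPair l t)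
include hlt

lemma exists_groupLike : ∃ g : H, IsGroupLikeElem k g ∧ ∀ h, hitL l h = l h • g := by
  have h1 (h : H) : hitL l h = l h • hitL l (antipode k t) := by
    refine eq_of_forall_functional (k := k) fun p => ?_
    have hp : IsRightIntegral (p ⋆ l) := fun q => by
      rw [conv_assoc, hlt.right]
      ext a
      simp [conv_apply_repr _ _ (ℛ k a), Finset.mul_sum, mul_left_comm]
    obtain ⟨c, hc⟩ := hlt.exists_eq_smul hp
    rw [map_smul, functional_hitL, functional_hitL, hc]
    simp [hlt.apply_antipode, mul_comm]
  refine ⟨hitL l (antipode k t), ⟨?_, ?_⟩, h1⟩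
  · rw [functional_hitL, ← functional_hitR, hitR_counit]
    exact hlt.apply_antipode
  · set g := hitL l (antipode k t) with hg
    have h2 : (comul : H →ₗ[k] H ⊗[k] H) ∘ₗ hitL l =
        LinearMap.mulRight k ((1 : H) ⊗ₜ[k] g) ∘ₗ inl.toLinearMap ∘ₗ hitL l := by
      have h3 : (inr (k := k) (H := H)).toLinearMap ⋆ scal _ l =
          LinearMap.mulRight k ((1 : H) ⊗ₜ[k] g) ∘ₗ scal _ l := by
        rw [← comp_hitL]
        ext h
        simp [h1, Algebra.algebraMap_eq_smul_one]
      rw [comp_hitL, comp_hitL, comul_eq_conv, conv_assoc, h3, mulRight_comp_conv]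
    have := LinearMap.congr_fun h2 (antipode k t)
    rw [LinearMap.comp_apply, ← hg] at this
    rw [this]
    simp [← hg]

omit [FiniteDimensional k H] in
lemma integral_ne_zero : t ≠ 0 := by
  rintro rfl
  simpa using hlt.apply_antipode

lemma exists_algHom : ∃ α : H →ₐ[k] k, ∀ h, t * h = α h • t := by
  have h1 (h : H) : t * h = l (antipode k (t * h)) • t :=
    hlt.eq_smul fun x => by rw [← mul_assoc, hlt.mul_eq, smul_mul_assoc]
  refine ⟨AlgHom.ofLinearMap (l ∘ₗ 𝑺 ∘ₗ LinearMap.mulLeft k t) ?_ ?_, h1⟩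
  · simp [hlt.apply_antipode]
  · intro x y
    simp only [LinearMap.comp_apply, LinearMap.mulLeft_apply]
    rw [← mul_assoc, h1 x, smul_mul_assoc, map_smul, map_smul, smul_eq_mul]
    simp [hlt.apply_antipode]

lemma hitL_comp_antipode (h : H) : hitL (l ∘ₗ 𝑺) h = algebraMap k H (l (antipode k h)) := by
  apply antipode_injective (k := k)
  rw [← hitR_antipode, hlt.right.hitR_eq]
  simp [Algebra.algebraMap_eq_smul_one]

lemma eq_sum' {ι : Type*} (r : Repr k t ι) (y : H) :
    y = ∑ i ∈ r.index, l (y * r.left i) • antipode k (r.right i) := by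
  refine hlt.eq_of_forall_apply_mul fun x => ?_
  conv_lhs => rw [hlt.eq_sum r x]
  simp [Finset.mul_sum, Finset.sum_mul, mul_comm]

section Radford

variable {α : H →ₐ[k] k} (hα : ∀ h, t * h = α h • t)
include hα

lemma apply_mul_comm (x h : H) :
    l (x * h) = l (antipode k (antipode k (hitR α.toLinearMap h)) * x) := by
  have h1 : (LinearMap.mulLeft k (comul t) ∘ₗ inl.toLinearMap) ⋆ inr.toLinearMap =
      LinearMap.mulLeft k (comul t) ∘ₗ scal (H ⊗[k] H) α.toLinearMap := by
    rw [← mulLeft_comp_conv, ← comul_eq_conv]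
    ext h
    have := congrArg (comul (R := k)) (hα h)
    rw [Bialgebra.comul_mul, map_smul] at this
    simp [this, Algebra.algebraMap_eq_smul_one]
  have h2 := congrArg (· ⋆ ((inr (k := k) (H := H)).toLinearMap ∘ₗ 𝑺)) h1
  simp only [conv_assoc, algHom_conv_antipode, conv_convUnit] at h2
  rw [← mulLeft_comp_conv, ← comp_hitR] at h2
  have h3 := LinearMap.congr_fun h2 h
  let r := ℛ k t
  simp only [LinearMap.comp_apply, LinearMap.mulLeft_apply, AlgHom.toLinearMap_apply, ← r.eq,
    Finset.sum_mul, Algebra.TensorProduct.includeLeft_apply,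
    Algebra.TensorProduct.includeRight_apply, Algebra.TensorProduct.tmul_mul_tmul, mul_one] at h3
  have h4 := congrArg (contractRight (l ∘ₗ 𝑺)) h3
  have h5 := congrArg (fun y => l (x * y)) h4
  simp only [map_sum, contractRight_tmul, LinearMap.comp_apply, antipode_mul_antidistrib,
    Finset.mul_sum, mul_smul_comm, map_smul, smul_eq_mul] at h5
  have h6 : ∑ i ∈ r.index, l (antipode k (r.right i)) • r.left i = 1 := by
    simpa [hitL_apply_repr _ r, hlt.apply_antipode] using hlt.hitL_comp_antipode t
  have h7 := hlt.eq_sum' r x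
  conv_rhs => rw [h7]
  conv_lhs => rw [← one_mul h, ← h6]
  simp only [Finset.sum_mul, Finset.mul_sum, map_sum, mul_smul_comm, smul_mul_assoc, map_smul,
    smul_eq_mul]
  rw [h5]
  simp [mul_comm]

variable {g : H} (hg : IsGroupLikeElem k g) (hgl : ∀ h, hitL l h = l h • g)
include hg hgl

omit hα in

lemma exists_apply_groupLike_mul : ∃ c : k, c ≠ 0 ∧ ∀ x, l (g * x) = c * l (antipode k x) := by
  let T := (LinearEquiv.ofBijective 𝑺 ⟨antipode_injective, antipode_surjective⟩).symm
  have hT (x : H) : T (antipode k x) = x :=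
    (LinearEquiv.ofBijective 𝑺 ⟨antipode_injective, antipode_surjective⟩).symm_apply_apply x
  let n : H →ₗ[k] k := l ∘ₗ LinearMap.mulLeft k g
  have hn (h : H) : hitL n h = n h • (1 : H) := by
    have h1 : hitL l (g * h) = g * hitL n h := by
      rw [← contractRight_comul, Bialgebra.comul_mul, hg.comul_eq_tmul_self,
        hitL_apply_repr _ (ℛ k h), ← (ℛ k h).eq, Finset.mul_sum]
      simp [n, Finset.mul_sum]
    rw [hgl] at h1
    have h2 := congrArg (antipode k g * ·) h1
    simp only [← mul_assoc, hg.antipode_mul_cancel, one_mul, mul_smul_comm] at h2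
    exact h2.symm
  have hm : IsRightIntegral (n ∘ₗ T.toLinearMap) := fun q => by
    ext x
    obtain ⟨h, rfl⟩ := antipode_surjective (k := k) x
    have e : (n ∘ₗ T.toLinearMap) ∘ₗ 𝑺 = n := by
      ext x
      simp [hT]
    rw [← functional_hitR, hitR_antipode, e, hn]
    simp [hT, mul_comm]
  obtain ⟨c, hc⟩ := hlt.exists_eq_smul hm
  have hc' (x : H) : l (g * x) = c * l (antipode k x) := by
    have := LinearMap.congr_fun hc (antipode k x)
    simpa [hT, n] using this
  refine ⟨c, ?_, hc'⟩
  rintro rfl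
  refine hlt.ne_zero (LinearMap.ext fun x => ?_)
  have := hc' (antipode k g * x)
  simpa [← mul_assoc, hg.mul_antipode_cancel] using this

/-- Radford's formula for the fourth power of the antipode. -/
lemma antipode_pow_four_eq (h : H) :
    antipode k (antipode k (antipode k (antipode k (hitR α.toLinearMap h)))) =
      g * hitL α.toLinearMap h * antipode k g := by
  obtain ⟨c, hc0, hc⟩ := hlt.exists_apply_groupLike_mul hg hgl
  set u := antipode k (antipode k (hitR α.toLinearMap h)) with hu
  set w := antipode k g * u * g with hw
  have h1 : antipode k h = antipode k (antipode k (hitR α.toLinearMap (antipode k w))) := by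
    refine hlt.eq_of_forall_apply_mul fun y => ?_
    obtain ⟨x, rfl⟩ := antipode_surjective (k := k) y
    rw [← hlt.apply_mul_comm hα, ← antipode_mul_antidistrib, ← antipode_mul_antidistrib]
    refine mul_left_cancel₀ hc0 ?_
    rw [← hc, ← hc, ← mul_assoc, hlt.apply_mul_comm hα, ← hu, hw]
    simp only [← mul_assoc, hg.mul_antipode_cancel, one_mul]
  rw [hitR_antipode] at h1
  replace h1 := antipode_injective (H := H) h1
  have h2 : hitL α.toLinearMap h = antipode k g * antipode k (antipode k u) * g := by
    rw [h1, hitL_antipode_antipode, ← LinearMap.comp_apply (hitL _), hitL_comp_hitL]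
    have h3 : α.toLinearMap ⋆ (α.toLinearMap ∘ₗ 𝑺) = counit := algHom_conv_antipode α
    rw [h3, hitL_counit, hw]
    simp only [LinearMap.id_apply, antipode_mul_antidistrib, hg.antipode_antipode]
  rw [h2]
  simp only [← mul_assoc, hg.mul_antipode_cancel, one_mul]
  simp only [mul_assoc, hg.mul_antipode_cancel, mul_one]

end Radford

end IsIntegralPair

/-- The representation of `Δ(xy)` induced by those of `Δ(x)` and `Δ(y)`. -/
noncomputable def reprMul {ι κ : Type*} {x y : H} (r : Repr k x ι) (s : Repr k y κ) :
    Repr k (x * y) (ι × κ) where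
  index := r.index ×ˢ s.index
  left i := r.left i.1 * s.left i.2
  right i := r.right i.1 * s.right i.2
  eq := by
    rw [Bialgebra.comul_mul, ← r.eq, ← s.eq, Finset.sum_mul_sum, Finset.sum_product]
    simp

lemma hitR_mul (α : H →ₐ[k] k) (x y : H) :
    hitR α.toLinearMap (x * y) = hitR α.toLinearMap x * hitR α.toLinearMap y := by
  rw [hitR_apply_repr _ (reprMul (ℛ k x) (ℛ k y)), hitR_apply_repr _ (ℛ k x),
    hitR_apply_repr _ (ℛ k y), Finset.sum_mul_sum]
  simp [reprMul, Finset.sum_product, smul_smul, mul_comm]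

lemma hitR_groupLike (q : H →ₗ[k] k) {g : H} (hg : IsGroupLikeElem k g) :
    hitR q g = q g • g := by
  rw [hitR_apply_repr q
    ({ index := {()}, left := fun _ => g, right := fun _ => g,
       eq := by simp [hg.comul_eq_tmul_self] } : Repr k g Unit)]
  simp

/-- `hitR` of a character, as an algebra endomorphism. -/
noncomputable def hitRAlgHom (α : H →ₐ[k] k) : H →ₐ[k] H :=
  AlgHom.ofLinearMap (hitR α.toLinearMap) (by simp [hitR_groupLike _ IsGroupLikeElem.one])
    (hitR_mul α)

/-- The map `x ⊗ y ↦ (x ⊗ 1) F(y)`. -/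
noncomputable def twist (F : H →ₗ[k] H ⊗[k] H) : Module.End k (H ⊗[k] H) :=
  TensorProduct.lift ((LinearMap.mul k (H ⊗[k] H)).compl₁₂ inl.toLinearMap F)

lemma twist_tmul (F : H →ₗ[k] H ⊗[k] H) (x y : H) :
    twist F (x ⊗ₜ[k] y) = inl (k := k) x * F y := rfl

lemma twist_inl_mul (F : H →ₗ[k] H ⊗[k] H) (x : H) (z : H ⊗[k] H) :
    twist F (inl (k := k) x * z) = inl (k := k) x * twist F z := by
  induction z with
  | zero => simp
  | tmul u v =>
    rw [Algebra.TensorProduct.includeLeft_apply, Algebra.TensorProduct.tmul_mul_tmul, one_mul,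
      twist_tmul, twist_tmul, map_mul, mul_assoc]
    rfl
  | add s t hs ht => rw [mul_add, map_add, map_add, hs, ht, mul_add]

lemma twist_mul_twist_comul :
    twist ((inl.toLinearMap ∘ₗ 𝑺) ⋆ inr.toLinearMap) * twist (comul : H →ₗ[k] H ⊗[k] H) = 1 := by
  have h1 (F : H →ₗ[k] H ⊗[k] H) (y : H) : twist F (comul y) = (inl.toLinearMap ⋆ F) y := by
    rw [conv_apply_repr _ _ (ℛ k y), ← (ℛ k y).eq]
    simp [twist_tmul]
  ext x y
  simp only [TensorProduct.AlgebraTensorModule.curry_apply, LinearMap.restrictScalars_self,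
    TensorProduct.curry_apply, Module.End.mul_apply, Module.End.one_apply]
  rw [twist_tmul, twist_inl_mul, h1, ← conv_assoc, algHom_conv_antipode, convUnit_conv]
  simp

lemma trace_eq_of_twist [FiniteDimensional k H] {a b : Module.End k (H ⊗[k] H)}
    (h : twist comul * a = b * twist comul) :
    LinearMap.trace k _ a = LinearMap.trace k _ b := by
  have h1 := twist_mul_twist_comul (k := k) (H := H)
  have h2 := mul_eq_one_comm.1 h1
  set E := twist (comul : H →ₗ[k] H ⊗[k] H)
  rw [← one_mul a, ← h1, mul_assoc, h, ← mul_assoc, LinearMap.trace_mul_comm, ← mul_assoc, h2,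
    one_mul]

lemma trace_hitR_sq [FiniteDimensional k H] (α : H →ₐ[k] k) :
    LinearMap.trace k H (hitR α.toLinearMap) ^ 2 =
      Module.finrank k H * LinearMap.trace k H (hitR α.toLinearMap) := by
  let R := hitRAlgHom α
  let M := Algebra.TensorProduct.map R (AlgHom.id k H)
  have h1 (y : H) : comul (R := k) (R y) = M (comul y) := by
    have h2 : (comul : H →ₗ[k] H ⊗[k] H) ∘ₗ hitR α.toLinearMap =
        (inl.toLinearMap ∘ₗ hitR α.toLinearMap) ⋆ inr.toLinearMap := by
      rw [comp_hitR, comp_hitR, comul_eq_conv, conv_assoc]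
    have h3 := LinearMap.congr_fun h2 y
    rw [conv_apply_repr _ _ (ℛ k y)] at h3
    rw [← (ℛ k y).eq, map_sum]
    have hR (x : H) : R x = hitR α.toLinearMap x := rfl
    simpa [M, hR] using h3
  have h4 : twist comul * TensorProduct.map (hitR α.toLinearMap) (hitR α.toLinearMap) =
      TensorProduct.map (hitR α.toLinearMap) LinearMap.id * twist comul := by
    ext x y
    simp only [TensorProduct.AlgebraTensorModule.curry_apply, LinearMap.restrictScalars_self,
      TensorProduct.curry_apply, Module.End.mul_apply, TensorProduct.map_tmul]
    rw [twist_tmul, twist_tmul]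
    change inl (k := k) (R x) * comul (R y) = M (inl (k := k) x * comul y)
    rw [map_mul, h1]
    simp [M]
  have h5 := trace_eq_of_twist h4
  rw [LinearMap.trace_tensorProduct', LinearMap.trace_tensorProduct', LinearMap.trace_id] at h5
  rw [sq, h5, mul_comm]

lemma trace_mulRight_sq [FiniteDimensional k H] {g : H} (hg : IsGroupLikeElem k g) :
    LinearMap.trace k H (LinearMap.mulRight k g) ^ 2 =
      Module.finrank k H * LinearMap.trace k H (LinearMap.mulRight k g) := by
  have h4 : twist comul * TensorProduct.map LinearMap.id (LinearMap.mulRight k g) =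
      TensorProduct.map (LinearMap.mulRight k g) (LinearMap.mulRight k g) * twist comul := by
    have h1 : TensorProduct.map (LinearMap.mulRight k g) (LinearMap.mulRight k g) =
        LinearMap.mulRight k (g ⊗ₜ[k] g) := by
      ext x y
      simp
    rw [h1]
    ext x y
    simp only [TensorProduct.AlgebraTensorModule.curry_apply, LinearMap.restrictScalars_self,
      TensorProduct.curry_apply, Module.End.mul_apply, TensorProduct.map_tmul]
    rw [twist_tmul, twist_tmul]
    simp [hg.comul_eq_tmul_self, mul_assoc]
  have h5 := trace_eq_of_twist h4
  rw [LinearMap.trace_tensorProduct', LinearMap.trace_tensorProduct', LinearMap.trace_id] at h5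
  rw [sq, h5]

/-- The convolution product of two characters. -/
noncomputable def convAlgHom (α β : H →ₐ[k] k) : H →ₐ[k] k :=
  AlgHom.ofLinearMap (α.toLinearMap ⋆ β.toLinearMap)
    (by rw [← functional_hitL, hitL_groupLike _ IsGroupLikeElem.one]; simp)
    (fun x y => by simp only [← functional_hitL, hitL_mul, AlgHom.toLinearMap_apply, map_mul])

lemma exists_algHom_pow (α : H →ₐ[k] k) (i : ℕ) : ∃ β : H →ₐ[k] k,
    hitR α.toLinearMap ^ i = hitR β.toLinearMap ∧ hitL α.toLinearMap ^ i = hitL β.toLinearMap ∧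
      ∀ g : H, IsGroupLikeElem k g → β g = α g ^ i := by
  induction i with
  | zero => exact ⟨Bialgebra.counitAlgHom k H, hitR_counit.symm, hitL_counit.symm,
      fun g hg => by simp [hg.counit_eq_one]⟩
  | succ i ih =>
    obtain ⟨β, h1, h2, h3⟩ := ih
    refine ⟨convAlgHom β α, ?_, ?_, fun g hg => ?_⟩
    · rw [pow_succ', h1]
      exact hitR_comp_hitR _ _
    · rw [pow_succ, h2]
      exact hitL_comp_hitL _ _
    · change (β.toLinearMap ⋆ α.toLinearMap) g = _
      rw [← functional_hitL, hitL_groupLike _ hg, pow_succ', ← h3 g hg]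
      simp

lemma hitR_injective {p q : H →ₗ[k] k} (h : hitR p = hitR q) : p = q := by
  ext x
  have h1 := congrArg (counit (R := k)) (LinearMap.congr_fun h x)
  rwa [functional_hitR, functional_hitR, ← functional_hitL, ← functional_hitL, hitL_counit] at h1

lemma isOfFinOrder_hitR [FiniteDimensional k H] (α : H →ₐ[k] k) :
    IsOfFinOrder (hitR α.toLinearMap) := by
  have : Finite (H →ₐ[k] k) :=
    (linearIndependent_toLinearMap k H k).finite_of_isNoetherian
  choose β hβ using exists_algHom_pow α
  have hu : IsUnit (hitR α.toLinearMap) := by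
    refine .of_mul_eq_one (hitR (α.toLinearMap ∘ₗ 𝑺)) ?_
    rw [Module.End.mul_eq_comp, hitR_comp_hitR, algHom_antipode_conv]
    exact hitR_counit
  obtain ⟨i, j, hij, heq⟩ := Finite.exists_ne_map_eq_of_infinite β
  wlog h : i < j generalizing i j
  · exact this j i hij.symm heq.symm (by lia)
  refine isOfFinOrder_iff_pow_eq_one.2 ⟨j - i, by lia, (hu.pow i).mul_left_cancel ?_⟩
  rw [← pow_add, Nat.add_sub_cancel' h.le, mul_one, (hβ i).1, (hβ j).1, heq]

lemma isOfFinOrder_groupLike [FiniteDimensional k H] {g : H} (hg : IsGroupLikeElem k g) :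
    IsOfFinOrder g := by
  have : Finite (GroupLike k H) := linearIndep_groupLikeVal.finite_of_isNoetherian
  obtain ⟨n, hn, h⟩ := isOfFinOrder_iff_pow_eq_one.1
    (isOfFinOrder_of_finite (⟨g, hg⟩ : GroupLike k H))
  exact isOfFinOrder_iff_pow_eq_one.2 ⟨n, hn, congrArg GroupLike.val h⟩

lemma linearIndependent_pow_groupLike {g : H} (hg : IsGroupLikeElem k g) {m : ℕ}
    (hm : m ≤ orderOf g) : LinearIndependent k fun i : Fin m => g ^ (i : ℕ) := by
  refine (linearIndep_groupLikeVal (R := k) (A := H)).comp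
    (fun i : Fin m => (⟨g ^ (i : ℕ), hg.pow⟩ : GroupLike k H)) fun i j hij => Fin.ext ?_
  exact pow_injOn_Iio_orderOf (lt_of_lt_of_le i.2 hm) (lt_of_lt_of_le j.2 hm)
    (congrArg GroupLike.val hij)

end HopfAlgebra

section Conclusion

open Module

/-- An operator `f` of finite order commuting with `s`, such that every power of `f` has trace
`0` or `dim V`, and `s` is traceless against every power of `f`. -/
structure IsTracelessPair {V : Type*} [AddCommGroup V] [Module ℂ V] (f s : End ℂ V) : Prop where
  isOfFinOrder : IsOfFinOrder f
  commute : Commute f s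
  trace_sq i : LinearMap.trace ℂ V (f ^ i) ^ 2 = finrank ℂ V * LinearMap.trace ℂ V (f ^ i)
  trace_mul i : LinearMap.trace ℂ V (f ^ i * s) = 0

namespace IsTracelessPair

variable {V : Type*} [AddCommGroup V] [Module ℂ V] {f s : End ℂ V} (h : IsTracelessPair f s)
include h

lemma mapsTo : ∀ x ∈ End.eigenspace f 1, s x ∈ End.eigenspace f 1 := fun x hx => by
  rw [End.mem_eigenspace_iff, one_smul] at hx ⊢
  have := LinearMap.congr_fun h.commute.eq x
  simpa [hx] using this

variable [FiniteDimensional ℂ V]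

lemma orderOf_mul_finrank : orderOf f * finrank ℂ (End.eigenspace f 1) = finrank ℂ V :=
  natCast_mul_finrank_eigenspace h.isOfFinOrder.orderOf_pos.ne' (pow_orderOf_eq_one f)
    (trace_pow_eq_zero h.isOfFinOrder h.trace_sq)

lemma trace_restrict : LinearMap.trace ℂ (End.eigenspace f 1) (s.restrict h.mapsTo) = 0 := by
  have h1 := sum_trace_pow_mul (pow_orderOf_eq_one f) h.mapsTo
  simp only [h.trace_mul, Finset.sum_const_zero] at h1
  exact (mul_eq_zero.1 h1.symm).resolve_left
    (Nat.cast_ne_zero.2 h.isOfFinOrder.orderOf_pos.ne')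

lemma pow_ne_one {r : ℕ} (hr : r.Prime) (hr2 : Odd r)
    (hodd : Odd (finrank ℂ (End.eigenspace f 1))) (hlt : finrank ℂ (End.eigenspace f 1) < r) :
    s ^ (2 * r) ≠ 1 := fun hs => by
  refine trace_ne_zero_of_pow_eq_one (T := s.restrict h.mapsTo) hr hr2 ?_ hodd hlt
    h.trace_restrict
  rw [End.pow_restrict]
  ext x
  simp [hs]

lemma not_eigenspace_le (hV : finrank ℂ V ≠ 0) : ¬ End.eigenspace f 1 ≤ End.eigenspace s 1 := by
  intro hle
  have h1 : s.restrict h.mapsTo = 1 := by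
    ext x
    simpa using End.mem_eigenspace_iff.1 (hle x.2)
  have h2 := h.trace_restrict
  rw [h1, LinearMap.trace_one, Nat.cast_eq_zero] at h2
  rw [← h.orderOf_mul_finrank, h2, mul_zero] at hV
  exact hV rfl

end IsTracelessPair

variable {H : Type*} [Ring H] [HopfAlgebra ℂ H]

local notation "𝑺" => (antipode ℂ (A := H) : End ℂ H)

lemma antipode_sq_apply (x : H) : (𝑺 ^ 2) x = antipode ℂ (antipode ℂ x) := by
  rw [sq, Module.End.mul_apply]

lemma orderOf_mulRight (g : H) : orderOf (LinearMap.mulRight ℂ g) = orderOf g := by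
  refine orderOf_eq_orderOf_iff.2 fun n => ?_
  rw [LinearMap.pow_mulRight]
  refine ⟨fun h => by simpa using LinearMap.congr_fun h 1, fun h => ?_⟩
  rw [h, LinearMap.mulRight_one]
  rfl

variable [FiniteDimensional ℂ H]

lemma eigenspace_le_of_groupLike {W : Submodule ℂ H} {g : H} (hg : IsGroupLikeElem ℂ g)
    (hle : finrank ℂ W ≤ orderOf g) (hgW : ∀ i, g ^ i ∈ W) : W ≤ End.eigenspace (𝑺 ^ 2) 1 := by
  have h1 : Submodule.span ℂ (Set.range fun i : Fin (finrank ℂ W) => g ^ (i : ℕ)) = W := by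
    refine Submodule.eq_of_le_of_finrank_eq (Submodule.span_le.2 ?_) ?_
    · rintro _ ⟨i, rfl⟩
      exact hgW i
    · rw [finrank_span_eq_card (linearIndependent_pow_groupLike hg hle), Fintype.card_fin]
  rw [← h1, Submodule.span_le]
  rintro _ ⟨i, rfl⟩
  rw [SetLike.mem_coe, End.mem_eigenspace_iff, one_smul, antipode_sq_apply]
  exact hg.pow.antipode_antipode

variable {l : H →ₗ[ℂ] ℂ} {t : H} (hlt : IsIntegralPair l t) (h0 : counit (R := ℂ) t = 0)
include hlt h0

lemma trace_mulRight_mul_antipode_sq (a : H) :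
    LinearMap.trace ℂ H (LinearMap.mulRight ℂ a * 𝑺 ^ 2) = 0 := by
  have h1 := traceForm_apply (k := ℂ) counit a
  rw [hlt.traceForm_eq, h0, zero_mul, hitR_counit] at h1
  rw [h1]
  rfl

lemma trace_hitR_mul_antipode_sq (β : H →ₐ[ℂ] ℂ) :
    LinearMap.trace ℂ H (hitR β.toLinearMap * 𝑺 ^ 2) = 0 := by
  have hβ : β t = 0 := by
    by_contra hne
    have h1 : counit (R := ℂ) t * β t = β t * β t := by
      rw [← map_mul, hlt.mul_eq, map_smul, smul_eq_mul]
    rw [h0, zero_mul, eq_comm, mul_self_eq_zero] at h1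
    exact hne h1
  have h1 := traceForm_apply (k := ℂ) β.toLinearMap (1 : H)
  rw [hlt.traceForm_eq, AlgHom.toLinearMap_apply, hβ, zero_mul, LinearMap.mulRight_one] at h1
  rw [LinearMap.trace_mul_comm, h1]
  rfl

lemma isTracelessPair_hitR (β : H →ₐ[ℂ] ℂ) :
    IsTracelessPair (hitR β.toLinearMap) (𝑺 ^ 2) where
  isOfFinOrder := isOfFinOrder_hitR β
  commute := by
    ext x
    simp only [Module.End.mul_apply, antipode_sq_apply, hitR_antipode_antipode]
  trace_sq i := by
    obtain ⟨γ, hγ, -⟩ := exists_algHom_pow β i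
    rw [hγ, trace_hitR_sq]
  trace_mul i := by
    obtain ⟨γ, hγ, -⟩ := exists_algHom_pow β i
    rw [hγ, trace_hitR_mul_antipode_sq hlt h0]

lemma isTracelessPair_mulRight {g : H} (hg : IsGroupLikeElem ℂ g) :
    IsTracelessPair (LinearMap.mulRight ℂ g) (𝑺 ^ 2) where
  isOfFinOrder := by
    obtain ⟨n, hn, h⟩ := isOfFinOrder_iff_pow_eq_one.1 (isOfFinOrder_groupLike hg)
    refine isOfFinOrder_iff_pow_eq_one.2 ⟨n, hn, ?_⟩
    rw [LinearMap.pow_mulRight, h]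
    ext; simp
  commute := by
    ext x
    simp [antipode_sq_apply, antipode_mul_antidistrib, hg.antipode_antipode]
  trace_sq i := by rw [LinearMap.pow_mulRight, trace_mulRight_sq hg.pow]
  trace_mul i := by
    rw [LinearMap.pow_mulRight, trace_mulRight_mul_antipode_sq hlt h0]

lemma orderOf_mul_orderOf_lt (β : H →ₐ[ℂ] ℂ) {g : H} (hg : IsGroupLikeElem ℂ g) (hβ : β g = 1) :
    orderOf (hitR β.toLinearMap) * orderOf g < finrank ℂ H := by
  have h := isTracelessPair_hitR hlt h0 β
  by_contra! hle
  rw [← h.orderOf_mul_finrank] at hle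
  refine h.not_eigenspace_le ?_ (eigenspace_le_of_groupLike hg
    (Nat.le_of_mul_le_mul_left hle h.isOfFinOrder.orderOf_pos) fun i => ?_)
  · exact fun hH => hlt.integral_ne_zero (finrank_zero_iff_forall_zero.1 hH t)
  · rw [End.mem_eigenspace_iff, hitR_groupLike _ hg.pow]
    simp [hβ]

lemma antipode_pow_four_ne_one (hodd : Odd (finrank ℂ H)) : 𝑺 ^ 4 ≠ 1 := by
  intro h4
  have h := isTracelessPair_hitR hlt h0 (Bialgebra.counitAlgHom ℂ H)
  have h1 : hitR (Bialgebra.counitAlgHom ℂ H).toLinearMap = (1 : End ℂ H) := hitR_counit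
  rw [h1] at h
  have h2 := h.orderOf_mul_finrank
  rw [orderOf_one, one_mul] at h2
  obtain ⟨r, hr1, hr⟩ := Nat.exists_infinite_primes (finrank ℂ H + 3)
  refine h.pow_ne_one hr (hr.odd_of_ne_two (by lia)) (h2 ▸ hodd) (by lia) ?_
  rw [← pow_mul, ← mul_assoc, pow_mul (𝑺) (2 * 2), h4, one_pow]

omit h0

lemma antipode_pow_four_pow_eq_one {α : H →ₐ[ℂ] ℂ} (hα : ∀ h, t * h = α h • t)
    {g : H} (hg : IsGroupLikeElem ℂ g) (hgl : ∀ h, hitL l h = l h • g) {n : ℕ}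
    (hgn : g ^ n = 1) (hαn : hitR α.toLinearMap ^ n = 1) : (𝑺 ^ 4) ^ n = 1 := by
  have hαn' : hitL α.toLinearMap ^ n = 1 := by
    obtain ⟨β, h1, h2, -⟩ := exists_algHom_pow α n
    rw [h2, hitR_injective (h1.symm.trans (hαn.trans hitR_counit.symm))]
    exact hitL_counit
  have h1 : 𝑺 ^ 4 * hitR α.toLinearMap =
      LinearMap.mulLeft ℂ g * LinearMap.mulRight ℂ (antipode ℂ g) * hitL α.toLinearMap := by
    ext x
    simpa [pow_succ, mul_assoc] using hlt.antipode_pow_four_eq hα hg hgl x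
  have h2 : Commute (𝑺 ^ 4) (hitR α.toLinearMap) := by
    have h5 : Commute (𝑺 ^ 2) (hitR α.toLinearMap) :=
      LinearMap.ext fun x => by simp [antipode_sq_apply, hitR_antipode_antipode]
    simpa only [← pow_mul] using h5.pow_left 2
  have h3 : Commute (LinearMap.mulLeft ℂ g) (LinearMap.mulRight ℂ (antipode ℂ g)) :=
    LinearMap.ext fun x => by simp [mul_assoc]
  have h4 : Commute (LinearMap.mulLeft ℂ g * LinearMap.mulRight ℂ (antipode ℂ g))
      (hitL α.toLinearMap) := by
    refine LinearMap.ext fun x => ?_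
    have h5 := hitL_groupLike α.toLinearMap hg
    have h6 := hitL_groupLike α.toLinearMap hg.antipode
    have h7 : α g * α (antipode ℂ g) = 1 := by
      rw [← map_mul, hg.mul_antipode_cancel, map_one]
    simp [hitL_mul, h5, h6, smul_smul, mul_comm, h7]
  have h8 : antipode ℂ g ^ n = 1 := by
    have h9 : Commute g (antipode ℂ g) := by
      rw [commute_iff_eq, hg.mul_antipode_cancel, hg.antipode_mul_cancel]
    rw [← one_mul (antipode ℂ g ^ n), ← hgn, ← h9.mul_pow, hg.mul_antipode_cancel, one_pow, hgn]
  have h10 := congrArg (· ^ n) h1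
  simp only [h2.mul_pow, h4.mul_pow, h3.mul_pow, hαn, hαn', LinearMap.pow_mulLeft,
    LinearMap.pow_mulRight, hgn, h8, LinearMap.mulLeft_one, LinearMap.mulRight_one, mul_one] at h10
  exact h10

end Conclusion

end HopfTools

open HopfTools Coalgebra HopfAlgebra in
/-- (Ng) For a non-semisimple Hopf algebra of dimension `p·q` over `ℂ`, where
`p < q` are odd primes, the fourth power of the antipode has order exactly `p`
in the monoid of `ℂ`-linear endomorphisms of `H`. -/
theorem antipode_fourth_power_order (p q : ℕ) (hp : p.Prime) (hq : q.Prime)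
    (hpodd : Odd p) (hqodd : Odd q) (hpq : p < q)
    (H : Type) [Ring H] [HopfAlgebra ℂ H]
    (hdim : Module.finrank ℂ H = p * q)
    (hns : ¬ IsSemisimpleRing H) :
    ((HopfAlgebra.antipode (R := ℂ) (A := H) : Module.End ℂ H) ^ 4) ^ p = 1 ∧
    ((HopfAlgebra.antipode (R := ℂ) (A := H) : Module.End ℂ H) ^ 4) ≠ 1 := by
  have hfin : FiniteDimensional ℂ H :=
    Module.finite_of_finrank_pos (hdim ▸ Nat.mul_pos hp.pos hq.pos)
  obtain ⟨l, t, hlt⟩ := exists_isIntegralPair ℂ H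
  have h0 : counit (R := ℂ) t = 0 := by
    by_contra hne
    exact hns (isSemisimpleRing_of_counit_ne_zero hlt.mul_eq hne)
  obtain ⟨g, hg, hgl⟩ := hlt.exists_groupLike
  obtain ⟨α, hα⟩ := hlt.exists_algHom
  refine ⟨?_, antipode_pow_four_ne_one hlt h0 (hdim ▸ hpodd.mul hqodd)⟩
  have hWα := isTracelessPair_hitR hlt h0 α
  have hWg := isTracelessPair_mulRight hlt h0 hg
  have hdα := hWα.orderOf_mul_finrank
  have hdg := hWg.orderOf_mul_finrank
  rw [orderOf_mulRight] at hdg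
  have hpow {n : ℕ} (h1 : orderOf g ∣ n) (h2 : orderOf (hitR α.toLinearMap) ∣ n) :=
    antipode_pow_four_pow_eq_one hlt hα hg hgl (orderOf_dvd_iff_pow_eq_one.1 h1)
      (orderOf_dvd_iff_pow_eq_one.1 h2)
  have hαg := orderOf_mul_orderOf_lt hlt h0 α hg
  have hα1 := orderOf_mul_orderOf_lt hlt h0 α IsGroupLikeElem.one (map_one α)
  have hεg := orderOf_mul_orderOf_lt hlt h0 (Bialgebra.counitAlgHom ℂ H) hg hg.counit_eq_one
  have hε : orderOf (hitR (Bialgebra.counitAlgHom ℂ H).toLinearMap) = 1 :=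
    orderOf_eq_one_iff.2 hitR_counit
  rw [orderOf_one, mul_one] at hα1
  rw [hε, one_mul] at hεg
  have hcop (h : Nat.Coprime (orderOf g) (orderOf (hitR α.toLinearMap))) : α g = 1 := by
    rw [← pow_one (α g), ← h, pow_gcd_eq_one, ← map_pow, pow_orderOf_eq_one, map_one]
    obtain ⟨β, h1, -, h3⟩ := exists_algHom_pow α (orderOf (hitR α.toLinearMap))
    rw [pow_orderOf_eq_one] at h1
    have h4 : β.toLinearMap = counit := hitR_injective (h1.symm.trans hitR_counit.symm)
    refine ⟨rfl, ?_⟩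
    rw [← h3 g hg, ← AlgHom.toLinearMap_apply, h4, hg.counit_eq_one]
  have hsq : ((antipode ℂ (A := H) : Module.End ℂ H) ^ 2) ^ (2 * q) =
      ((antipode ℂ (A := H) : Module.End ℂ H) ^ 4) ^ q := by
    rw [← pow_mul, ← pow_mul]
    congr 1
    lia
  have hnα (h : Module.finrank ℂ (Module.End.eigenspace (hitR α.toLinearMap) 1) = p) :=
    hsq ▸ hWα.pow_ne_one hq hqodd (h ▸ hpodd) (h ▸ hpq)
  have hng (h : Module.finrank ℂ (Module.End.eigenspace (LinearMap.mulRight ℂ g) 1) = p) :=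
    hsq ▸ hWg.pow_ne_one hq hqodd (h ▸ hpodd) (h ▸ hpq)
  have hcases {n m : ℕ} (h : n * m = p * q) (hn : n < p * q) :
      n = 1 ∨ n = p ∨ (n = q ∧ m = p) := by
    obtain ⟨x, y, hx, hy, rfl⟩ := Nat.dvd_mul.1 (Dvd.intro m h)
    rcases (Nat.dvd_prime hp).1 hx with rfl | rfl <;> rcases (Nat.dvd_prime hq).1 hy with rfl | rfl
    · simp
    · refine .inr (.inr ⟨one_mul y, Nat.eq_of_mul_eq_mul_left hq.pos ?_⟩)
      rw [← one_mul y, h, one_mul, mul_comm]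
    · simp
    · exact absurd hn (lt_irrefl _)
  have hpq' : Nat.Coprime p q := (Nat.coprime_primes hp hq).2 hpq.ne
  rw [hdim] at hdα hdg hαg hα1 hεg
  rcases hcases hdα hα1 with hb | hb | ⟨hb, hb'⟩ <;>
    rcases hcases hdg hεg with ha | ha | ⟨ha, ha'⟩ <;> rw [hb, ha] at hpow hcop hαg
  · exact hpow (one_dvd p) (one_dvd p)
  · exact hpow dvd_rfl (one_dvd p)
  · exact absurd (hpow dvd_rfl (one_dvd q)) (hng ha')
  · exact hpow (one_dvd p) dvd_rfl
  · exact hpow dvd_rfl dvd_rfl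
  · exact absurd (hαg (hcop hpq'.symm)) (lt_irrefl _)
  · exact absurd (hpow (one_dvd q) dvd_rfl) (hnα hb')
  · exact absurd (mul_comm q p ▸ hαg (hcop hpq')) (lt_irrefl _)
  · exact absurd (hpow dvd_rfl dvd_rfl) (hnα hb')
end

section
/- Let H be a finite-dimensional Hopf algebra over ℂ, let p be a prime, and let χ : H → ℂ be an algebra homomorphism (a character of H) such that the associated algebra endomorphism f_χ of H satisfies f_χ^p = id_H and f_χ ≠ id_H (i.e., χ is a grouplike element of H* of order p). If V is a finite-dimensional simple H-module such that the twist of V along f_χ is isomorphic to V as an H-module, then p divides dim(V). -/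
open TensorProduct in
/-- Pre- and post-composition on a space of linear maps has trace the product of the traces. -/
theorem LinearMap.trace_of_forall_apply_eq_comp {K M N : Type*} [CommRing K]
    [AddCommGroup M] [Module K M] [Module.Free K M] [Module.Finite K M]
    [AddCommGroup N] [Module K N] [Module.Free K N] [Module.Finite K N]
    (a : Module.End K N) (b : Module.End K M) (T : Module.End K (M →ₗ[K] N))
    (hT : ∀ F, T F = a ∘ₗ F ∘ₗ b) :
    LinearMap.trace K _ T = LinearMap.trace K M b * LinearMap.trace K N a := by
  have key : (dualTensorHomEquiv K M N).conj
      (TensorProduct.map (Module.Dual.transpose (R := K) b) a) = T := by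
    refine LinearMap.ext fun F => ?_
    obtain ⟨x, rfl⟩ := (dualTensorHomEquiv K M N).surjective F
    rw [LinearEquiv.conj_apply_apply, LinearEquiv.symm_apply_apply, hT]
    induction x with
    | zero => simp
    | add x y hx hy => simp only [map_add, hx, hy, LinearMap.add_comp, LinearMap.comp_add]
    | tmul φ n =>
      ext m
      simp [dualTensorHomEquiv, Module.Dual.transpose]
  rw [← key]
  refine (LinearMap.trace_conj' (M := Module.Dual K M ⊗[K] N) (N := M →ₗ[K] N) _
    (dualTensorHomEquiv K M N)).trans ?_
  rw [LinearMap.trace_tensorProduct', LinearMap.trace_transpose']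

open TensorProduct Coalgebra in
/-- Convolution with a functional on the left commutes with the right coaction. -/
theorem LinearMap.comul_lid_map_comul {R C : Type*} [CommSemiring R] [AddCommMonoid C]
    [Module R C] [Coalgebra R C] (χ : C →ₗ[R] R) (f : Module.End R C)
    (hf : ∀ a : C, f a = TensorProduct.lid R C (TensorProduct.map χ LinearMap.id (comul a)))
    (a : C) : comul (R := R) (f a) = f.rTensor C (comul a) := by
  have hfc : f = (TensorProduct.lid R C).toLinearMap ∘ₗ χ.rTensor C ∘ₗ comul :=
    LinearMap.ext hf
  have h₁ : ∀ x : C ⊗[R] C, comul (R := R) (TensorProduct.lid R C (χ.rTensor C x)) =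
      (TensorProduct.lid R C).toLinearMap.rTensor C ((χ.rTensor C).rTensor C
        ((TensorProduct.assoc R C C C).symm (comul.lTensor C x))) := by
    intro x
    induction x with
    | zero => simp
    | add x y hx hy => simp only [map_add, hx, hy]
    | tmul c d =>
      simp only [LinearMap.rTensor_tmul, LinearMap.lTensor_tmul, TensorProduct.lid_tmul, map_smul]
      induction comul (R := R) d with
      | zero => simp
      | add x y hx hy => simp only [map_add, smul_add, tmul_add, hx, hy]
      | tmul u v => simp [TensorProduct.smul_tmul']
  have h₂ := h₁ (comul a)
  rw [Coalgebra.coassoc_symm_apply] at h₂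
  rw [hfc]
  simpa only [LinearMap.rTensor_comp, LinearMap.comp_apply, LinearEquiv.coe_coe] using h₂

open Coalgebra WithConv in
/-- An endomorphism `e` of a module which intertwines the action of a Hopf algebra `H` with its
twist by a right colinear endomorphism `f` of `H` is traceless, unless `trace f = dim H`. -/
theorem HopfAlgebra.trace_eq_zero_of_intertwines {K H V : Type*} [Field K] [CharZero K]
    [Ring H] [HopfAlgebra K H] [FiniteDimensional K H]
    [AddCommGroup V] [Module K V] [FiniteDimensional K V]
    (ρ : H →ₐ[K] Module.End K V) (f : Module.End K H)
    (hf : ∀ a, comul (R := K) (f a) = f.rTensor H (comul a))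
    (htr : LinearMap.trace K H f ≠ Module.finrank K H)
    (e : Module.End K V) (he : ∀ x, e * ρ (f x) = ρ x * e) :
    LinearMap.trace K V e = 0 := by
  let r : WithConv (H →ₗ[K] Module.End K V) := toConv ρ.toLinearMap
  let s : WithConv (H →ₗ[K] Module.End K V) := toConv (ρ.toLinearMap ∘ₗ antipode K)
  have hrs : r * s = 1 := by
    have := LinearMap.algHom_comp_convMul_distrib ρ (toConv LinearMap.id)
      (toConv (antipode K (A := H)))
    rw [LinearMap.id_mul_antipode] at this
    refine congrArg toConv (Eq.trans this.symm ?_)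
    ext; simp [LinearMap.convOne_def]
  have hsr : s * r = 1 := by
    have := LinearMap.algHom_comp_convMul_distrib ρ
      (toConv (antipode K (A := H))) (toConv LinearMap.id)
    rw [LinearMap.antipode_mul_id] at this
    refine congrArg toConv (Eq.trans this.symm ?_)
    ext; simp [LinearMap.convOne_def]
  let c : WithConv (H →ₗ[K] Module.End K V) ≃ₗ[K] (H →ₗ[K] Module.End K V) :=
    WithConv.linearEquiv K _
  let L : (H →ₗ[K] Module.End K V) ≃ₗ[K] (H →ₗ[K] Module.End K V) :=
    LinearEquiv.ofLinearMap (c.conj (LinearMap.mulLeft K r)) (c.conj (LinearMap.mulLeft K s))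
      (by ext1 F; simp [LinearEquiv.conj_apply, ← mul_assoc, hrs])
      (by ext1 F; simp [LinearEquiv.conj_apply, ← mul_assoc, hsr])
  let ℓ : Module.End K (Module.End K V) := LinearMap.mulLeft K e
  let T₁ : Module.End K (H →ₗ[K] Module.End K V) := LinearMap.compRight K ℓ
  let T₂ : Module.End K (H →ₗ[K] Module.End K V) := T₁ ∘ₗ LinearMap.lcomp K _ f
  have hL : L.conj T₁ = T₂ := by
    refine LinearMap.ext fun F => ?_
    obtain ⟨F, rfl⟩ := L.surjective F
    rw [LinearEquiv.conj_apply_apply, LinearEquiv.symm_apply_apply]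
    ext1 h
    change LinearMap.mul' K _ (TensorProduct.map ρ.toLinearMap (ℓ ∘ₗ F) (comul h)) =
      e * LinearMap.mul' K _ (TensorProduct.map ρ.toLinearMap F (comul (f h)))
    rw [hf]
    induction comul (R := K) h with
    | zero => simp
    | add x y hx hy => simp only [map_add, mul_add, hx, hy]
    | tmul x y => simp [ℓ, ← mul_assoc, he]
  have htrace := LinearMap.trace_conj' T₁ L
  have hℓ : LinearMap.trace K _ ℓ = Module.finrank K V * LinearMap.trace K V e := by
    rw [LinearMap.trace_of_forall_apply_eq_comp e LinearMap.id ℓ fun F => rfl, LinearMap.trace_id]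
  rw [hL, LinearMap.trace_of_forall_apply_eq_comp ℓ f T₂ fun F => rfl,
    LinearMap.trace_of_forall_apply_eq_comp ℓ LinearMap.id T₁ fun F => rfl, LinearMap.trace_id,
    hℓ] at htrace
  by_contra hne
  have hV : (Module.finrank K V : K) ≠ 0 := by
    intro h0
    have := Module.finrank_zero_iff.mp (Nat.cast_eq_zero.mp h0)
    exact hne (by rw [Subsingleton.elim e 0, map_zero])
  exact htr (mul_right_cancel₀ (mul_ne_zero hV hne) htrace)

/-- A finite-order endomorphism whose trace is the dimension is the identity. -/
theorem Module.End.eq_one_of_pow_eq_one_of_trace_eq_finrank {W : Type*} [AddCommGroup W]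
    [Module ℂ W] [FiniteDimensional ℂ W] (f : Module.End ℂ W) {n : ℕ} (hn : n ≠ 0)
    (hf : f ^ n = 1) (htr : LinearMap.trace ℂ W f = Module.finrank ℂ W) : f = 1 := by
  have hss : f.IsSemisimple := by
    refine isSemisimple_of_squarefree_aeval_eq_zero (p := Polynomial.X ^ n - 1) ?_ (by simp [hf])
    exact (Polynomial.separable_X_pow_sub_C (1 : ℂ) (by exact_mod_cast hn) one_ne_zero).squarefree
  have hsplit : f.charpoly.Splits := IsAlgClosed.splits _
  have hnorm : ∀ μ ∈ f.charpoly.roots, ‖μ‖ = 1 := by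
    intro μ hμ
    have hev : f.HasEigenvalue μ := by
      rw [Module.End.hasEigenvalue_iff_isRoot_charpoly]
      exact Polynomial.isRoot_of_mem_roots hμ
    obtain ⟨v, hv⟩ := hev.exists_hasEigenvector
    have h := hv.pow_apply n
    rw [hf, Module.End.one_apply] at h
    have : μ ^ n = 1 := by
      by_contra hne
      have : (μ ^ n - 1) • v = 0 := by rw [sub_smul, one_smul, ← h, sub_self]
      exact (smul_eq_zero.mp this).elim (sub_ne_zero.mpr hne) hv.2
    exact Complex.norm_eq_one_of_pow_eq_one this hn
  have hcard : f.charpoly.roots.card = Module.finrank ℂ W := by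
    rw [← hsplit.natDegree_eq_card_roots, LinearMap.charpoly_natDegree]
  have hsum : (f.charpoly.roots.map fun μ => 1 - μ.re).sum = 0 := by
    have h := congrArg Complex.re htr
    rw [Module.End.trace_eq_sum_roots_charpoly_of_splits hsplit, ← hcard] at h
    have h' := map_multiset_sum Complex.reAddGroupHom f.charpoly.roots
    simp only [Complex.coe_reAddGroupHom] at h'
    rw [Multiset.sum_map_sub, ← h', h]
    simp
  have hone : ∀ μ ∈ f.charpoly.roots, μ = 1 := by
    intro μ hμ
    have hle : ∀ x ∈ f.charpoly.roots.map fun μ => 1 - μ.re, 0 ≤ x := by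
      intro x hx
      obtain ⟨ν, hν, rfl⟩ := Multiset.mem_map.mp hx
      linarith [Complex.re_le_norm ν, hnorm ν hν]
    have := Multiset.all_zero_of_le_zero_le_of_sum_eq_zero hle hsum _
      (Multiset.mem_map_of_mem _ hμ)
    have hre : μ.re = 1 := by linarith
    have h2 := Complex.sq_norm μ
    rw [hnorm μ hμ, Complex.normSq_apply, hre] at h2
    exact Complex.ext hre (by simpa using (show μ.im * μ.im = 0 by linarith))
  have hnil : IsNilpotent (f - 1) := by
    refine ⟨Module.finrank ℂ W, ?_⟩
    have h := LinearMap.aeval_self_charpoly f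
    rw [hsplit.eq_prod_roots_of_monic f.charpoly_monic,
      Multiset.eq_replicate.mpr ⟨hcard, hone⟩] at h
    simpa using h
  have hss' : (f - 1).IsSemisimple := by
    have h := hss.aeval (Polynomial.X - 1)
    rwa [map_sub, Polynomial.aeval_X, map_one] at h
  exact sub_eq_zero.mp (eq_zero_of_isNilpotent_isSemisimple hnil hss')

/-- If `e ^ n = 1` and all nontrivial powers of `e` are traceless, then `n` divides the
dimension. -/
theorem Module.End.dvd_finrank_of_trace_pow_eq_zero {K V : Type*} [Field K] [CharZero K]
    [AddCommGroup V] [Module K V] [FiniteDimensional K V] (e : Module.End K V) {n : ℕ}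
    (hn : n ≠ 0) (he : e ^ n = 1)
    (htr : ∀ k, 0 < k → k < n → LinearMap.trace K V (e ^ k) = 0) :
    n ∣ Module.finrank K V := by
  have hn' : (n : K) ≠ 0 := by exact_mod_cast hn
  set S : Module.End K V := ∑ k ∈ Finset.range n, e ^ k with hS
  have heS : e * S = S := by
    have h := mul_geom_sum e n
    rw [he, sub_self, sub_mul, one_mul] at h
    exact sub_eq_zero.mp h
  have hpow : ∀ k, e ^ k * S = S := by
    intro k
    induction k with
    | zero => simp
    | succ k ih => rw [pow_succ, mul_assoc, heS, ih]
  have hSS : S * S = (n : K) • S := by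
    calc S * S = ∑ k ∈ Finset.range n, e ^ k * S := by rw [← Finset.sum_mul]
      _ = (n : K) • S := by simp [hpow, Nat.cast_smul_eq_nsmul]
  have hidem : IsIdempotentElem ((n : K)⁻¹ • S) := by
    rw [IsIdempotentElem, smul_mul_smul_comm, hSS, smul_smul, mul_assoc, inv_mul_cancel₀ hn',
      mul_one]
  have htS : LinearMap.trace K V S = Module.finrank K V := by
    rw [hS, map_sum, Finset.sum_eq_single_of_mem 0 (by simp; omega)]
    · simp
    · intro k hk hk0
      exact htr k (Nat.pos_of_ne_zero hk0) (Finset.mem_range.mp hk)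
  have hrank := (LinearMap.IsIdempotentElem.isProj_range _ hidem).trace
  rw [map_smul, htS, smul_eq_mul, inv_mul_eq_iff_eq_mul₀ hn'] at hrank
  exact ⟨_, by exact_mod_cast hrank⟩

/-- Let `H` be a finite-dimensional Hopf algebra over `ℂ` and `χ : H → ℂ` a character
whose associated endomorphism `f_χ = (χ ⊗ id) ∘ Δ` of `H` has order exactly `p`
(`p` prime), i.e. `χ` is a grouplike element of `H*` of order `p`. If `V` is a
finite-dimensional simple `H`-module whose twist along `f_χ` (the module `χ ⊗ V`)
is isomorphic to `V`, then `p` divides `dim V`. -/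
theorem char_stable_simple_dim_dvd
    (H : Type) [Ring H] [HopfAlgebra ℂ H] [FiniteDimensional ℂ H]
    (p : ℕ) (hp : p.Prime)
    (χ : H →ₐ[ℂ] ℂ)
    (fχ : Module.End ℂ H)
    (hfχ : ∀ a : H, fχ a =
      (TensorProduct.lid ℂ H)
        (TensorProduct.map χ.toLinearMap LinearMap.id (Coalgebra.comul (R := ℂ) a)))
    (hord : fχ ^ p = 1) (hne : fχ ≠ 1)
    (V : Type) [AddCommGroup V] [Module ℂ V] [Module H V] [IsScalarTower ℂ H V]
    (hsimple : IsSimpleModule H V) (hfd : FiniteDimensional ℂ V)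
    (hstable : ∃ e : V ≃ₗ[ℂ] V, ∀ (x : H) (v : V), e (fχ x • v) = x • e v) :
    p ∣ Module.finrank ℂ V := by
  obtain ⟨e, he⟩ := hstable
  let ρ : H →ₐ[ℂ] Module.End ℂ V := Algebra.lsmul ℂ ℂ V
  have hcomul := LinearMap.comul_lid_map_comul χ.toLinearMap fχ hfχ
  have : Nontrivial V := IsSimpleModule.nontrivial H V
  have hpowe : ∀ (k : ℕ) (x : H) (v : V),
      ((e : Module.End ℂ V) ^ k) ((fχ ^ k) x • v) = x • ((e : Module.End ℂ V) ^ k) v := by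
    intro k
    induction k with
    | zero => simp
    | succ k ih =>
      intro x v
      rw [pow_succ' fχ, pow_succ (e : Module.End ℂ V), Module.End.mul_apply, Module.End.mul_apply,
        Module.End.mul_apply]
      exact (congrArg _ (he _ v)).trans (ih x (e v))
  obtain ⟨c, hc⟩ : ∃ c : ℂ, (e : Module.End ℂ V) ^ p = c • 1 := by
    let E : Module.End H V :=
      { toFun := ((e : Module.End ℂ V) ^ p : Module.End ℂ V)
        map_add' := map_add _
        map_smul' := fun x v => by simpa [hord] using hpowe p x v }
    obtain ⟨c, hc⟩ := (IsSimpleModule.algebraMap_end_bijective_of_isAlgClosed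
      (A := H) (V := V) ℂ).2 E
    exact ⟨c, LinearMap.ext fun v => (LinearMap.congr_fun hc v).symm⟩
  have hc0 : c ≠ 0 := by
    rintro rfl
    have h := (IsUnit.pow p ((Module.End.isUnit_iff _).mpr e.bijective) :
      IsUnit ((e : Module.End ℂ V) ^ p))
    rw [hc, zero_smul] at h
    exact not_isUnit_zero h
  obtain ⟨d, hd⟩ := IsAlgClosed.exists_pow_nat_eq c hp.pos
  have : Fact p.Prime := ⟨hp⟩
  refine Module.End.dvd_finrank_of_trace_pow_eq_zero (d⁻¹ • (e : Module.End ℂ V)) hp.ne_zero ?_ ?_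
  · rw [smul_pow, hc, smul_smul, inv_pow, hd, inv_mul_cancel₀ hc0, one_smul]
  · intro k hk hkp
    rw [smul_pow, map_smul]
    have hcomulk : ∀ a, Coalgebra.comul (R := ℂ) ((fχ ^ k) a) =
        (fχ ^ k).rTensor H (Coalgebra.comul a) := by
      clear hk hkp
      induction k with
      | zero => simp [Module.End.one_eq_id]
      | succ k ih =>
        intro a
        rw [pow_succ, Module.End.mul_apply, ih, hcomul, LinearMap.rTensor_mul,
          Module.End.mul_apply]
    rw [HopfAlgebra.trace_eq_zero_of_intertwines ρ (fχ ^ k) hcomulk ?_ _ ?_, smul_zero]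
    · intro htr
      have h1 := Module.End.eq_one_of_pow_eq_one_of_trace_eq_finrank (fχ ^ k) hp.ne_zero
        (by rw [← pow_mul, mul_comm, pow_mul, hord, one_pow]) htr
      have := Nat.le_of_dvd hk (orderOf_dvd_of_pow_eq_one h1)
      rw [orderOf_eq_prime hord hne] at this
      omega
    · exact fun x => LinearMap.ext fun v => hpowe k x v
end

section
/- Let A be a finite-dimensional ℂ-algebra, let p be a positive integer, set z = exp(πi/p), and let σ : A → A be an algebra automorphism such that A is spanned as a ℂ-vector space by elements x satisfying σ(x) = z^m x for some integer m (i.e., by eigenvectors of σ whose eigenvalues are 2p-th roots of unity). Let Q be a nonzero finite-dimensional indecomposable A-module and let a : Q → Q be a ℂ-linear automorphism satisfying a(x • v) = σ(x) • a(v) for all x ∈ A, v ∈ Q. Then for any two eigenvalues λ, μ of a one has (λ/μ)^{2p} = 1, i.e., λ/μ is a power of z. -/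
/-- Fitting's lemma for indecomposable modules: an endomorphism with nontrivial kernel is
nilpotent. -/
theorem isNilpotent_of_ker_ne_bot_of_indecomposable {R M : Type*} [Ring R] [AddCommGroup M]
    [Module R M] [IsNoetherian R M] [IsArtinian R M]
    (hindec : ¬ ∃ W₁ W₂ : Submodule R M, W₁ ≠ ⊥ ∧ W₂ ≠ ⊥ ∧ IsCompl W₁ W₂)
    (f : Module.End R M) (hf : LinearMap.ker f ≠ ⊥) : IsNilpotent f := by
  obtain ⟨n, hcompl, hn⟩ := (f.eventually_isCompl_ker_pow_range_pow.and
    (Filter.eventually_ge_atTop 1)).exists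
  refine ⟨n, ?_⟩
  by_contra hne
  refine hindec ⟨_, _, fun hker => hf ?_, fun hrange => hne ?_, hcompl⟩
  · rw [eq_bot_iff, ← hker]
    intro v hv
    obtain ⟨k, rfl⟩ := Nat.exists_eq_add_of_le' hn
    rw [LinearMap.mem_ker] at hv ⊢
    rw [pow_succ, Module.End.mul_apply, hv, map_zero]
  · exact LinearMap.range_eq_bot.mp hrange

/-- An endomorphism of an indecomposable module of
finite length over a `K`-algebra has at most one eigenvalue. -/
theorem eigenvalue_unique_of_indecomposable {K A Q : Type*} [Field K] [Ring A] [Algebra K A]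
    [AddCommGroup Q] [Module K Q] [Module A Q] [IsScalarTower K A Q]
    [IsNoetherian A Q] [IsArtinian A Q]
    (hindec : ¬ ∃ W₁ W₂ : Submodule A Q, W₁ ≠ ⊥ ∧ W₂ ≠ ⊥ ∧ IsCompl W₁ W₂)
    (f : Module.End A Q) {c d : K} {v w : Q} (hv : v ≠ 0) (hw : w ≠ 0)
    (hfv : f v = c • v) (hfw : f w = d • w) : d = c := by
  have : SMulCommClass A K Q := IsScalarTower.to_smulCommClass'
  let g : Module.End A Q := f - c • (1 : Module.End A Q)
  have hgv : g v = 0 := by simp [g, hfv]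
  have hgw : g w = (d - c) • w := by simp [g, hfw, sub_smul]
  obtain ⟨n, hn⟩ := isNilpotent_of_ker_ne_bot_of_indecomposable hindec g
    fun h => hv (LinearMap.ker_eq_bot'.mp h v hgv)
  have hpow : ∀ k : ℕ, (g ^ k) w = (d - c) ^ k • w := by
    intro k
    induction k with
    | zero => simp
    | succ k ih =>
      rw [pow_succ, Module.End.mul_apply, hgw, LinearMap.map_smul_of_tower, ih, smul_smul,
        pow_succ']
  have h := hpow n
  rw [hn, LinearMap.zero_apply, eq_comm, smul_eq_zero_iff_left hw] at h
  exact sub_eq_zero.mp (pow_eq_zero_iff (n := n) (by rintro rfl; simp at h) |>.mp h)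

/-- Let `A` be a finite-dimensional `ℂ`-algebra spanned by eigenvectors of an
algebra automorphism `σ` whose eigenvalues are powers of `z = exp(πi/p)`, let `Q`
be a nonzero finite-dimensional indecomposable `A`-module, and let `a : Q → Q` be
a `ℂ`-linear automorphism with `a (x • v) = σ(x) • a v`. Then the ratio of any two
eigenvalues of `a` is a `2p`-th root of unity, i.e. a power of `z`. -/
theorem eigenvalue_ratios_are_roots_of_unity
    (p : ℕ) (hp : 0 < p) (z : ℂ) (hz : z = Complex.exp (Real.pi * Complex.I / p))
    (A : Type) [Ring A] [Algebra ℂ A] [FiniteDimensional ℂ A]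
    (σ : A ≃ₐ[ℂ] A)
    (hspan : Submodule.span ℂ {x : A | ∃ m : ℤ, σ x = z ^ m • x} = ⊤)
    (Q : Type) [AddCommGroup Q] [Module ℂ Q] [Module A Q] [IsScalarTower ℂ A Q]
    [FiniteDimensional ℂ Q] (hQnt : Nontrivial Q)
    (hindec : ¬ ∃ W₁ W₂ : Submodule A Q, W₁ ≠ ⊥ ∧ W₂ ≠ ⊥ ∧ IsCompl W₁ W₂)
    (a : Q ≃ₗ[ℂ] Q)
    (ha : ∀ (x : A) (v : Q), a (x • v) = σ x • a v)
    (lam mu : ℂ)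
    (hlam : ∃ v : Q, v ≠ 0 ∧ a v = lam • v)
    (hmu : ∃ v : Q, v ≠ 0 ∧ a v = mu • v) :
    (lam / mu) ^ (2 * p) = 1 := by
  have hzpow : z ^ (2 * p) = 1 := by
    have hp' : (p : ℂ) ≠ 0 := Nat.cast_ne_zero.mpr hp.ne'
    rw [hz, ← Complex.exp_nat_mul, ← Complex.exp_two_pi_mul_I]
    congr 1
    push_cast
    field_simp
  have hσiter : ∀ x : A, σ^[2 * p] x = x := by
    intro x
    rw [← AlgEquiv.coe_pow]
    have hx : x ∈ Submodule.span ℂ {x : A | ∃ m : ℤ, σ x = z ^ m • x} := hspan ▸ Submodule.mem_top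
    induction hx using Submodule.span_induction with
    | zero => exact map_zero _
    | add x y _ _ hx hy => rw [map_add, hx, hy]
    | smul c x _ hx => rw [map_smul, hx]
    | mem x hx =>
      obtain ⟨m, hm⟩ := hx
      have hk : ∀ k : ℕ, σ^[k] x = (z ^ m) ^ k • x := by
        intro k
        induction k with
        | zero => simp
        | succ k ih =>
          rw [Function.iterate_succ_apply', ih, map_smul, hm, smul_smul, pow_succ]
      rw [AlgEquiv.coe_pow, hk, ← zpow_natCast, ← zpow_mul, mul_comm, zpow_mul, zpow_natCast, hzpow,
        one_zpow, one_smul]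
  have haiter : ∀ (k : ℕ) (x : A) (v : Q), a^[k] (x • v) = σ^[k] x • a^[k] v := by
    intro k x v
    induction k with
    | zero => rfl
    | succ k ih => simp only [Function.iterate_succ_apply', ih, ha]
  let b : Module.End A Q :=
    { toFun := a^[2 * p]
      map_add' := iterate_map_add a _
      map_smul' := fun x v => by rw [haiter, hσiter, RingHom.id_apply] }
  have heig : ∀ (c : ℂ) (v : Q), a v = c • v → b v = c ^ (2 * p) • v := by
    intro c v hv
    change a^[2 * p] v = _
    induction 2 * p with
    | zero => simp
    | succ k ih => rw [Function.iterate_succ_apply', ih, map_smul, hv, smul_smul, pow_succ]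
  have : IsNoetherian A Q := isNoetherian_of_tower ℂ inferInstance
  have : IsArtinian A Q := isArtinian_of_tower ℂ inferInstance
  obtain ⟨v, hv, hav⟩ := hlam
  obtain ⟨w, hw, haw⟩ := hmu
  have hmu0 : mu ≠ 0 := by
    rintro rfl
    exact hw (a.map_eq_zero_iff.mp (by rw [haw, zero_smul]))
  rw [div_pow, eigenvalue_unique_of_indecomposable hindec b hw hv (heig mu w haw) (heig lam v hav),
    div_self (pow_ne_zero _ hmu0)]
end

section
/- Let p be an odd prime and set z = exp(πi/p) ∈ ℂ. Let m₀, m₁, …, m_{2p−1} be natural numbers such that ∑_{j=0}^{2p−1} m_j z^j = 0 and ∑_{j=0}^{2p−1} m_j is odd. Then ∑_{j=0}^{2p−1} m_j ≥ p. -/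
/-- The negative of a primitive `2 * p`-th root of unity, `p` an odd prime, is a primitive
`p`-th root of unity. -/
theorem IsPrimitiveRoot.neg_of_two_mul_odd_prime {K : Type*} [Field K] {p : ℕ} {ζ : K}
    (hp : p.Prime) (hpodd : Odd p) (hζ : IsPrimitiveRoot ζ (2 * p)) :
    IsPrimitiveRoot (-ζ) p := by
  have : Fact p.Prime := ⟨hp⟩
  have hpow : ζ ^ p = -1 :=
    (hζ.pow (by have := hp.pos; lia) (mul_comm 2 p)).eq_neg_one_of_two_right
  rw [IsPrimitiveRoot.iff_orderOf]
  refine orderOf_eq_prime (by rw [hpodd.neg_pow, hpow, neg_neg]) fun h ↦ ?_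
  have hdvd : 2 * p ∣ 2 := hζ.dvd_of_pow_eq_one 2 (by rw [← neg_sq, h, one_pow])
  have := Nat.le_of_dvd two_pos hdvd
  have := hp.two_le
  lia

/-- A vanishing sum of an odd number of `2 * p`-th roots of unity, `p` an odd prime,
has at least `p` terms. -/
theorem IsPrimitiveRoot.le_sum_of_odd_of_sum_eq_zero {K : Type*} [Field K] [CharZero K]
    {p n : ℕ} {ζ : K} (hp : p.Prime) (hpodd : Odd p) (hn : n = p + p)
    (hζ : IsPrimitiveRoot ζ n) (m : Fin n → ℕ)
    (hsum : ∑ j, (m j : K) * ζ ^ (j : ℕ) = 0) (hodd : Odd (∑ j, m j)) :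
    p ≤ ∑ j, m j := by
  subst hn
  rw [← two_mul] at hζ
  have hpow : ζ ^ p = -1 :=
    (hζ.pow (by have := hp.pos; lia) (mul_comm 2 p)).eq_neg_one_of_two_right
  let α : Fin p → ℤ := fun i ↦
    (-1) ^ (i : ℕ) * ((m (Fin.castAdd p i) : ℤ) - m (Fin.natAdd p i))
  have hα : ∀ i j, α i = α j := by
    rw [← (hζ.neg_of_two_mul_odd_prime hp hpodd).sum_eq_zero_iff_forall_eq_int hp α, ← hsum,
      Fin.sum_univ_add, ← Finset.sum_add_distrib]
    refine Finset.sum_congr rfl fun i _ ↦ ?_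
    have hsq : (-1 : K) ^ (i : ℕ) * (-1) ^ (i : ℕ) = 1 := by
      rw [← mul_pow, neg_one_mul, neg_neg, one_pow]
    simp only [α, Fin.val_castAdd, Fin.val_natAdd, pow_add, hpow, neg_pow ζ]
    push_cast
    linear_combination
      ((m (Fin.castAdd p i) : K) - m (Fin.natAdd p i)) * ζ ^ (i : ℕ) * hsq
  have hα_zero (i : Fin p) : α i = 0 ↔ m (Fin.castAdd p i) = m (Fin.natAdd p i) := by
    simp [α, sub_eq_zero]
  rw [Fin.sum_univ_add, ← Finset.sum_add_distrib] at hodd ⊢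
  by_cases h : ∃ i, α i = 0
  · obtain ⟨i, hi⟩ := h
    refine absurd hodd (Nat.not_odd_iff_even.mpr (Finset.even_sum _ fun j _ ↦ ?_))
    rw [(hα_zero j).mp ((hα j i).trans hi)]
    exact Even.add_self _
  · push Not at h
    calc p = ∑ _i : Fin p, 1 := by simp
      _ ≤ _ := Finset.sum_le_sum fun i _ ↦ by
        have := mt (hα_zero i).mpr (h i)
        lia

/-- Let `p` be an odd prime, `z = exp(πi/p)`, and `m₀, …, m_{2p-1}` natural numbers
with `∑ mⱼ zʲ = 0` and `∑ mⱼ` odd. Then `∑ mⱼ ≥ p`. -/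
theorem sum_multiplicities_ge (p : ℕ) (hp : p.Prime) (hpodd : Odd p)
    (z : ℂ) (hz : z = Complex.exp (Real.pi * Complex.I / p))
    (m : Fin (2 * p) → ℕ)
    (hsum : ∑ j : Fin (2 * p), (m j : ℂ) * z ^ (j : ℕ) = 0)
    (hodd : Odd (∑ j : Fin (2 * p), m j)) :
    p ≤ ∑ j : Fin (2 * p), m j := by
  have hprim : IsPrimitiveRoot z (2 * p) := by
    convert! Complex.isPrimitiveRoot_exp (2 * p) (by have := hp.pos; lia) using 1
    rw [hz]
    congr 1
    push_cast
    rw [mul_assoc, mul_div_mul_left _ _ two_ne_zero]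
  exact hprim.le_sum_of_odd_of_sum_eq_zero hp hpodd (two_mul p) m hsum hodd
end
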